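/- arXiv:2601.14018 — 10 statements merged into one kernel-verified Lean document; each statement's English description precedes it below -/
import Mathlib

section
/- For every real p > 1, the integral ∫₀¹ (1 − s^p)^{−1/p} ds converges and satisfies 2·∫₀¹ (1 − s^p)^{−1/p} ds = 2π / (p·sin(π/p)). -/
open Real MeasureTheory

/-- On the open unit interval the complex Beta integrand with real parameters is real. -/
lemma beta_integrand_ofReal (a b : ℝ) {x : ℝ} (hx : x ∈ Set.Ioo (0 : ℝ) 1) :
    (x : ℂ) ^ ((a : ℂ) - 1) * (1 - (x : ℂ)) ^ ((b : ℂ) - 1) =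
      ((x ^ (a - 1) * (1 - x) ^ (b - 1) : ℝ) : ℂ) := by
  rw [Complex.ofReal_mul, Complex.ofReal_cpow hx.1.le, Complex.ofReal_cpow (by linarith [hx.2])]
  push_cast
  rfl

/-- The real Beta integral converges for positive parameters. -/
lemma integrableOn_beta_integrand {a b : ℝ} (ha : 0 < a) (hb : 0 < b) :
    IntegrableOn (fun x : ℝ => x ^ (a - 1) * (1 - x) ^ (b - 1)) (Set.Ioo 0 1) := by
  have h := (intervalIntegrable_iff_integrableOn_Ioo_of_le zero_le_one).1
    (Complex.betaIntegral_convergent (u := a) (v := b) (by simpa) (by simpa))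
  refine h.re.congr (ae_restrict_of_forall_mem measurableSet_Ioo fun x hx => ?_)
  simp only [beta_integrand_ofReal a b hx]
  exact Complex.ofReal_re _

/-- The real Beta integral in terms of the Gamma function. -/
lemma integral_beta_integrand {a b : ℝ} (ha : 0 < a) (hb : 0 < b) :
    ∫ x in Set.Ioo (0 : ℝ) 1, x ^ (a - 1) * (1 - x) ^ (b - 1) =
      Gamma a * Gamma b / Gamma (a + b) := by
  have h : Complex.betaIntegral a b =
      ((∫ x in Set.Ioo (0 : ℝ) 1, x ^ (a - 1) * (1 - x) ^ (b - 1) : ℝ) : ℂ) := by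
    rw [Complex.betaIntegral, intervalIntegral.integral_of_le zero_le_one,
      integral_Ioc_eq_integral_Ioo, ← integral_complex_ofReal]
    exact setIntegral_congr_fun measurableSet_Ioo fun x hx => beta_integrand_ofReal a b hx
  have h' := ProbabilityTheory.beta_eq_betaIntegralReal a b ha hb
  rw [h, Complex.ofReal_re] at h'
  exact h'.symm

lemma image_rpow_Ioo_zero_one {p : ℝ} (hp : 0 < p) :
    (fun x : ℝ => x ^ p) '' Set.Ioo 0 1 = Set.Ioo 0 1 := by
  ext y
  constructor
  · rintro ⟨x, hx, rfl⟩
    exact ⟨rpow_pos_of_pos hx.1 p, rpow_lt_one hx.1.le hx.2 hp⟩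
  · intro hy
    exact ⟨y ^ p⁻¹, ⟨rpow_pos_of_pos hy.1 _, rpow_lt_one hy.1.le hy.2 (inv_pos.2 hp)⟩,
      rpow_inv_rpow hy.1.le hp.ne'⟩

/-- For every real `p > 1`, the integral `∫₀¹ (1 - s^p)^(-1/p) ds` converges and
`2 * ∫₀¹ (1 - s^p)^(-1/p) ds = 2π / (p * sin (π/p))`. -/
theorem stmt0 (p : ℝ) (hp : 1 < p) :
    IntervalIntegrable (fun s : ℝ => (1 - s ^ p) ^ (-1 / p)) volume 0 1 ∧
    2 * ∫ s in (0:ℝ)..1, (1 - s ^ p) ^ (-1 / p) = 2 * π / (p * Real.sin (π / p)) := by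
  have hp0 : 0 < p := by linarith
  have ha : 0 < p⁻¹ := inv_pos.2 hp0
  have hb : 0 < 1 - p⁻¹ := sub_pos.2 (inv_lt_one_of_one_lt₀ hp)
  have hderiv : ∀ x ∈ Set.Ioo (0 : ℝ) 1,
      HasDerivWithinAt (fun x : ℝ => x ^ p) (p * x ^ (p - 1)) (Set.Ioo 0 1) x :=
    fun x hx => (hasDerivAt_rpow_const (Or.inl hx.1.ne')).hasDerivWithinAt
  have hinj : Set.InjOn (fun x : ℝ => x ^ p) (Set.Ioo 0 1) :=
    (rpow_left_injOn hp0.ne').mono fun x hx => hx.1.le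
  have hsubst : ∀ x ∈ Set.Ioo (0 : ℝ) 1,
      |p * x ^ (p - 1)| • ((x ^ p) ^ (p⁻¹ - 1) * (1 - x ^ p) ^ (1 - p⁻¹ - 1)) =
        p * (1 - x ^ p) ^ (-1 / p) := by
    intro x hx
    have hx0 : 0 < x := hx.1
    have hcancel : x ^ (p - 1) * (x ^ p) ^ (p⁻¹ - 1) = 1 := by
      rw [← rpow_mul hx0.le, ← rpow_add hx0,
        show p - 1 + p * (p⁻¹ - 1) = 0 by field_simp; ring, rpow_zero]
    rw [abs_of_pos (by positivity), smul_eq_mul, show 1 - p⁻¹ - 1 = -1 / p by ring]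
    linear_combination p * (1 - x ^ p) ^ (-1 / p) * hcancel
  constructor
  · rw [intervalIntegrable_iff_integrableOn_Ioo_of_le zero_le_one]
    have h := integrableOn_beta_integrand ha hb
    rw [← image_rpow_Ioo_zero_one hp0,
      integrableOn_image_iff_integrableOn_abs_deriv_smul measurableSet_Ioo hderiv hinj,
      integrableOn_congr_fun hsubst measurableSet_Ioo] at h
    exact (integrable_const_mul_iff (isUnit_iff_ne_zero.2 hp0.ne') _).1 h
  · have h := integral_beta_integrand ha hb
    rw [← image_rpow_Ioo_zero_one hp0,
      integral_image_eq_integral_abs_deriv_smul measurableSet_Ioo hderiv hinj,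
      setIntegral_congr_fun measurableSet_Ioo hsubst, integral_const_mul,
      add_sub_cancel, Gamma_one, div_one, Gamma_mul_Gamma_one_sub, ← div_eq_mul_inv] at h
    rw [intervalIntegral.integral_of_le zero_le_one, integral_Ioc_eq_integral_Ioo,
      mul_comm p, ← div_div, mul_div_assoc, ← h]
    field_simp
end

section
/- Let p > 1, β > 0 and D > 0. Then there exists a unique α > 0 such that ∫₀^{π_p/2} dφ / (α + β·cos_p(φ)^{p−1}·sin_p(φ)) = D. -/
open Real MeasureTheory Set

/-- `arcsin_p(x) = ∫₀ˣ (1 - s^p)^(-1/p) ds`. -/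
noncomputable def arcsinP (p x : ℝ) : ℝ := ∫ s in (0:ℝ)..x, (1 - s ^ p) ^ (-1 / p)

/-- `π_p = 2 arcsin_p(1)`. -/
noncomputable def piP (p : ℝ) : ℝ := 2 * arcsinP p 1

/-- The integrand defining `arcsinP` is integrable on `[0, 1]`. -/
theorem intervalIntegrable_arcsinP_integrand {p : ℝ} (hp : 1 < p) :
    IntervalIntegrable (fun s : ℝ => (1 - s ^ p) ^ (-1 / p)) volume 0 1 := by
  have hexp : -1 < -1 / p := by
    rw [lt_div_iff₀ (by linarith)]; linarith
  have h : IntervalIntegrable (fun s : ℝ => (1 - s) ^ (-1 / p)) volume 0 1 := by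
    have := (intervalIntegral.intervalIntegrable_rpow' (a := 0) (b := 1) hexp).comp_sub_left 1
    simpa using this.symm
  have hmeas : Measurable fun s : ℝ => (1 - s ^ p) ^ (-1 / p) :=
    ((measurable_id.pow_const p).const_sub 1).pow_const _
  refine h.mono_fun hmeas.aestronglyMeasurable ?_
  rw [uIoc_of_le zero_le_one]
  refine (ae_restrict_iff' measurableSet_Ioc).2 (Filter.Eventually.of_forall fun s hs => ?_)
  have hle : s ^ p ≤ s := by
    simpa using rpow_le_rpow_of_exponent_ge hs.1 hs.2 hp.le
  have hs1 : s ≤ 1 := hs.2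
  change ‖(1 - s ^ p) ^ (-1 / p)‖ ≤ ‖(1 - s) ^ (-1 / p)‖
  rcases hs1.lt_or_eq with hlt | rfl
  · rw [norm_of_nonneg (rpow_nonneg (by linarith) _), norm_of_nonneg (rpow_nonneg (by linarith) _)]
    exact rpow_le_rpow_of_nonpos (by linarith) (by linarith)
      (div_nonpos_of_nonpos_of_nonneg (by norm_num) (by linarith))
  · simp

theorem monotoneOn_arcsinP {p : ℝ} (hp : 1 < p) : MonotoneOn (arcsinP p) (Icc 0 1) := by
  intro x hx y hy hxy
  refine intervalIntegral.integral_mono_interval le_rfl hx.1 hxy ?_ ?_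
  · refine (ae_restrict_iff' measurableSet_Ioc).2 (Filter.Eventually.of_forall fun s hs => ?_)
    exact rpow_nonneg (sub_nonneg.2
      (rpow_le_one hs.1.le (hs.2.trans hy.2) (by linarith))) _
  · refine (intervalIntegrable_arcsinP_integrand hp).mono_set ?_
    rw [uIcc_of_le hy.1, uIcc_of_le zero_le_one]
    exact Icc_subset_Icc_right hy.2

theorem le_arcsinP {p x : ℝ} (hp : 1 < p) (hx : x ∈ Icc (0 : ℝ) 1) : x ≤ arcsinP p x := by
  have h : ∫ _ in (0 : ℝ)..x, (1 : ℝ) ≤ arcsinP p x := by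
    refine intervalIntegral.integral_mono_on_of_le_Ioo hx.1 (by simp) ?_ ?_
    · refine (intervalIntegrable_arcsinP_integrand hp).mono_set ?_
      rw [uIcc_of_le hx.1, uIcc_of_le zero_le_one]
      exact Icc_subset_Icc_right hx.2
    · intro s hs
      have hs1 : s ^ p < 1 := rpow_lt_one hs.1.le (hs.2.trans_le hx.2) (by linarith)
      have hs0 : 0 ≤ s ^ p := rpow_nonneg hs.1.le _
      exact one_le_rpow_of_pos_of_le_one_of_nonpos (by linarith) (by linarith)
        (div_nonpos_of_nonpos_of_nonneg (by norm_num) (by linarith))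
  simpa using h

theorem intervalIntegrable_one_div_add {L α : ℝ} {g : ℝ → ℝ} (hL : 0 < L) (hα : 0 < α)
    (hg : AEMeasurable g (volume.restrict (Icc 0 L))) (hg0 : ∀ t ∈ Icc 0 L, 0 ≤ g t) :
    IntervalIntegrable (fun t => 1 / (α + g t)) volume 0 L := by
  have hg' : AEMeasurable g (volume.restrict (uIoc 0 L)) := by
    rw [uIoc_of_le hL.le]
    exact hg.mono_measure (Measure.restrict_mono Ioc_subset_Icc_self le_rfl)
  refine (intervalIntegrable_const (c := 1 / α)).mono_fun
    ((hg'.const_add α).const_div 1).aestronglyMeasurable ?_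
  refine (ae_restrict_iff' measurableSet_uIoc).2 (Filter.Eventually.of_forall fun t ht => ?_)
  rw [uIoc_of_le hL.le] at ht
  have := hg0 t (Ioc_subset_Icc_self ht)
  change ‖1 / (α + g t)‖ ≤ ‖1 / α‖
  rw [norm_of_nonneg (by positivity), norm_of_nonneg (by positivity)]
  exact one_div_le_one_div_of_le hα (by linarith)

theorem strictAntiOn_integral_one_div_add {L : ℝ} {g : ℝ → ℝ} (hL : 0 < L)
    (hg : AEMeasurable g (volume.restrict (Icc 0 L))) (hg0 : ∀ t ∈ Icc 0 L, 0 ≤ g t) :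
    StrictAntiOn (fun α => ∫ t in (0 : ℝ)..L, 1 / (α + g t)) (Ioi 0) := by
  intro a ha b hb hab
  have hia := intervalIntegrable_one_div_add hL ha hg hg0
  have hib := intervalIntegrable_one_div_add hL hb hg hg0
  rw [← sub_pos, ← intervalIntegral.integral_sub hia hib]
  refine intervalIntegral.intervalIntegral_pos_of_pos_on (hia.sub hib) (fun t ht => ?_) hL
  have := hg0 t (Ioo_subset_Icc_self ht)
  have ha' : 0 < a := ha
  exact sub_pos.2 (one_div_lt_one_div_of_lt (by linarith) (by linarith))

theorem continuousOn_integral_one_div_add {L : ℝ} {g : ℝ → ℝ} (hL : 0 < L)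
    (hg : AEMeasurable g (volume.restrict (Icc 0 L))) (hg0 : ∀ t ∈ Icc 0 L, 0 ≤ g t) :
    ContinuousOn (fun α => ∫ t in (0 : ℝ)..L, 1 / (α + g t)) (Ioi 0) := by
  intro a ha
  have ha' : 0 < a := ha
  refine ContinuousAt.continuousWithinAt ?_
  refine intervalIntegral.continuousAt_of_dominated_interval (bound := fun _ => 1 / (a / 2))
    ?_ ?_ intervalIntegrable_const ?_
  · filter_upwards [lt_mem_nhds ha'] with b hb
    exact (intervalIntegrable_iff.1
      (intervalIntegrable_one_div_add hL hb hg hg0)).aestronglyMeasurable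
  · filter_upwards [lt_mem_nhds (half_lt_self ha')] with b hb
    refine Filter.Eventually.of_forall fun t ht => ?_
    rw [uIoc_of_le hL.le] at ht
    have := hg0 t (Ioc_subset_Icc_self ht)
    rw [norm_of_nonneg (one_div_nonneg.2 (by linarith))]
    exact one_div_le_one_div_of_le (by linarith) (by linarith)
  · refine Filter.Eventually.of_forall fun t ht => ?_
    rw [uIoc_of_le hL.le] at ht
    have := hg0 t (Ioc_subset_Icc_self ht)
    exact continuousAt_const.div (continuousAt_id.add continuousAt_const)
      (by linarith)

theorem integral_one_div_add_mul {L α β : ℝ} (hL : 0 < L) (hα : 0 < α) (hβ : 0 < β) :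
    ∫ t in (0 : ℝ)..L, 1 / (α + β * t) = log (1 + β * L / α) / β := by
  have h := intervalIntegral.integral_comp_add_mul (a := 0) (b := L)
    (fun x : ℝ => 1 / x) hβ.ne' α
  rw [h, integral_one_div_of_pos (by simpa using hα) (by positivity), smul_eq_mul]
  have : (α + β * L) / (α + β * 0) = 1 + β * L / α := by field_simp; ring
  rw [this]
  ring

/-- If `0 ≤ g t ≤ β t` on `[0, L]`, then `α ↦ ∫₀ᴸ dt / (α + g t)` takes every positive value
exactly once on `(0, ∞)`. -/
theorem existsUnique_integral_one_div_add_eq {L β D : ℝ} {g : ℝ → ℝ} (hL : 0 < L) (hβ : 0 < β)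
    (hD : 0 < D) (hg : AEMeasurable g (volume.restrict (Icc 0 L)))
    (hg0 : ∀ t ∈ Icc 0 L, 0 ≤ g t) (hgβ : ∀ t ∈ Icc 0 L, g t ≤ β * t) :
    ∃! α : ℝ, 0 < α ∧ ∫ t in (0 : ℝ)..L, 1 / (α + g t) = D := by
  have hE : 0 < exp (β * D) - 1 := sub_pos.2 (one_lt_exp_iff.2 (by positivity))
  have ha : 0 < β * L / (exp (β * D) - 1) := by positivity
  have hb : 0 < L / D := by positivity
  have hlow : D ≤ ∫ t in (0 : ℝ)..L, 1 / (β * L / (exp (β * D) - 1) + g t) := by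
    have hval : ∫ t in (0 : ℝ)..L, 1 / (β * L / (exp (β * D) - 1) + β * t) = D := by
      rw [integral_one_div_add_mul hL ha hβ, div_div_cancel₀ (by positivity),
        add_sub_cancel, log_exp, mul_div_cancel_left₀ _ hβ.ne']
    refine hval.symm.le.trans (intervalIntegral.integral_mono_on hL.le
      (intervalIntegrable_one_div_add hL ha (by fun_prop) fun t ht => mul_nonneg hβ.le ht.1)
      (intervalIntegrable_one_div_add hL ha hg hg0) fun t ht => ?_)
    have := hg0 t ht
    have := hgβ t ht
    exact one_div_le_one_div_of_le (by linarith) (by linarith)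
  have hupp : ∫ t in (0 : ℝ)..L, 1 / (L / D + g t) ≤ D := by
    have hval : ∫ _ in (0 : ℝ)..L, 1 / (L / D) = D := by
      rw [intervalIntegral.integral_const, smul_eq_mul]
      field_simp
      ring
    refine (intervalIntegral.integral_mono_on hL.le
      (intervalIntegrable_one_div_add hL hb hg hg0) intervalIntegrable_const
      fun t ht => ?_).trans_eq hval
    have := hg0 t ht
    exact one_div_le_one_div_of_le hb (by linarith)
  obtain ⟨α, hα, hαD⟩ := isPreconnected_Ioi.intermediate_value (mem_Ioi.2 hb) (mem_Ioi.2 ha)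
    (continuousOn_integral_one_div_add hL hg hg0) ⟨hupp, hlow⟩
  exact ⟨α, ⟨hα, hαD⟩, fun γ hγ => (strictAntiOn_integral_one_div_add hL hg hg0).injOn
    hγ.1 hα (hγ.2.trans hαD.symm)⟩

/-- for `p > 1`, `β > 0` and `D > 0`, there exists a unique `α > 0` such that
`∫₀^{π_p/2} dφ / (α + β cos_p(φ)^(p-1) sin_p(φ)) = D`. -/
theorem stmt5 (p β D : ℝ) (hp : 1 < p) (hβ : 0 < β) (hD : 0 < D) (sinp : ℝ → ℝ)
    (hmaps : ∀ t ∈ Icc (0:ℝ) (piP p / 2), sinp t ∈ Icc (0:ℝ) 1)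
    (hleft : ∀ x ∈ Icc (0:ℝ) 1, sinp (arcsinP p x) = x)
    (hright : ∀ t ∈ Icc (0:ℝ) (piP p / 2), arcsinP p (sinp t) = t) :
    ∃! α : ℝ, 0 < α ∧
      (∫ φ in (0:ℝ)..(piP p / 2),
        1 / (α + β * ((1 - sinp φ ^ p) ^ (1 / p)) ^ (p - 1) * sinp φ)) = D := by
  have hL : 0 < piP p / 2 := by
    have := le_arcsinP hp (right_mem_Icc.2 zero_le_one)
    rw [piP]
    linarith
  have hmono : MonotoneOn sinp (Icc 0 (piP p / 2)) := by
    intro s hs t ht hst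
    by_contra! hlt
    have h := monotoneOn_arcsinP hp (hmaps t ht) (hmaps s hs) hlt.le
    rw [hright t ht, hright s hs] at h
    exact hlt.ne (by rw [le_antisymm hst h])
  have hmeas := aemeasurable_restrict_of_monotoneOn (μ := volume) measurableSet_Icc hmono
  have hcos : ∀ t ∈ Icc (0 : ℝ) (piP p / 2), 0 ≤ 1 - sinp t ^ p ∧ 1 - sinp t ^ p ≤ 1 := by
    intro t ht
    have h0 := rpow_nonneg (hmaps t ht).1 p
    have h1 := rpow_le_one (hmaps t ht).1 (hmaps t ht).2 (by linarith : 0 ≤ p)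
    constructor <;> linarith
  refine existsUnique_integral_one_div_add_eq hL hβ hD ?_ (fun t ht => ?_) (fun t ht => ?_)
  · exact ((((hmeas.pow_const p).const_sub 1).pow_const _).pow_const _ |>.const_mul β).mul hmeas
  · exact mul_nonneg (mul_nonneg hβ.le (rpow_nonneg (rpow_nonneg (hcos t ht).1 _) _))
      (hmaps t ht).1
  · have hle : sinp t ≤ t := (le_arcsinP hp (hmaps t ht)).trans_eq (hright t ht)
    have hc : ((1 - sinp t ^ p) ^ (1 / p)) ^ (p - 1) ≤ 1 :=
      rpow_le_one (rpow_nonneg (hcos t ht).1 _)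
        (rpow_le_one (hcos t ht).1 (hcos t ht).2 (by positivity)) (by linarith)
    exact mul_le_mul (mul_le_of_le_one_right hβ.le hc) hle (hmaps t ht).1 hβ.le
end

section
/- Let p > 1, a > 0 and D > 0. Then there exist λ > 0 and a continuously differentiable function w : [0,D] → ℝ with w(0) = 0, w(D) = 1, w'(D) = 0, w(t) > 0 for all t ∈ (0,D], such that t ↦ |w'(t)|^{p−2}·w'(t) is differentiable on (0,D) and d/dt(|w'(t)|^{p−2}·w'(t)) + a·|w'(t)|^{p−2}·w'(t) + λ·|w(t)|^{p−2}·w(t) = 0 for all t ∈ (0,D). -/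
open Real MeasureTheory Set
open Filter Topology

/-- The speed `dt/dz` of time with respect to `z = w / w'` along a positive solution. -/
noncomputable def timeDensity (p a lam s : ℝ) : ℝ :=
  (p - 1) / (p - 1 + a * |s| + lam * |s| ^ p)

/-- The rate `-d(log w')/dz` of decay of `w'` with respect to `z = w / w'`. -/
noncomputable def decayRate (p a lam s : ℝ) : ℝ :=
  (a + lam * |s| ^ (p - 1)) / (p - 1 + a * |s| + lam * |s| ^ p)

/-- The time at which `w / w'` reaches the value `z`. -/
noncomputable def timeOf (p a lam z : ℝ) : ℝ := ∫ s in 0..z, timeDensity p a lam s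

/-- The value of `w'` when `w / w' = z`, normalized to be `1` at `z = 0`. -/
noncomputable def slopeOf (p a lam z : ℝ) : ℝ := exp (-∫ s in 0..z, decayRate p a lam s)

section

variable {p a lam : ℝ}

lemma timeDensity_denom_pos (hp : 1 < p) (ha : 0 < a) (hl : 0 < lam) (s : ℝ) :
    0 < p - 1 + a * |s| + lam * |s| ^ p := by
  have : 0 < p - 1 := by linarith
  positivity

lemma timeDensity_pos (hp : 1 < p) (ha : 0 < a) (hl : 0 < lam) (s : ℝ) :
    0 < timeDensity p a lam s :=
  div_pos (by linarith) (timeDensity_denom_pos hp ha hl s)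

lemma continuous_timeDensity (hp : 1 < p) (ha : 0 < a) (hl : 0 < lam) :
    Continuous (timeDensity p a lam) := by
  have : Continuous fun s : ℝ => |s| ^ p :=
    continuous_abs.rpow_const fun _ => Or.inr (by linarith)
  exact Continuous.div (by fun_prop) (by fun_prop) fun s => (timeDensity_denom_pos hp ha hl s).ne'

lemma continuous_decayRate (hp : 1 < p) (ha : 0 < a) (hl : 0 < lam) :
    Continuous (decayRate p a lam) := by
  have h1 : Continuous fun s : ℝ => |s| ^ p :=
    continuous_abs.rpow_const fun _ => Or.inr (by linarith)
  have h2 : Continuous fun s : ℝ => |s| ^ (p - 1) :=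
    continuous_abs.rpow_const fun _ => Or.inr (by linarith)
  exact Continuous.div (by fun_prop) (by fun_prop) fun s => (timeDensity_denom_pos hp ha hl s).ne'

lemma decayRate_nonneg (hp : 1 < p) (ha : 0 < a) (hl : 0 < lam) (s : ℝ) :
    0 ≤ decayRate p a lam s :=
  div_nonneg (by positivity) (timeDensity_denom_pos hp ha hl s).le

lemma one_sub_mul_decayRate (hp : 1 < p) (ha : 0 < a) (hl : 0 < lam) {z : ℝ} (hz : 0 ≤ z) :
    1 - z * decayRate p a lam z = timeDensity p a lam z := by
  have h := timeDensity_denom_pos hp ha hl z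
  have hpow : |z| ^ p = |z| ^ (p - 1) * z := by
    rw [abs_of_nonneg hz]
    nth_rewrite 1 [show p = p - 1 + 1 by ring]
    rw [rpow_add_one' hz (by linarith)]
  rw [timeDensity, decayRate, eq_div_iff h.ne', sub_mul, mul_assoc, div_mul_cancel₀ _ h.ne',
    hpow, abs_of_nonneg hz]
  ring

lemma hasStrictDerivAt_timeOf (hp : 1 < p) (ha : 0 < a) (hl : 0 < lam) (z : ℝ) :
    HasStrictDerivAt (timeOf p a lam) (timeDensity p a lam z) z :=
  (continuous_timeDensity hp ha hl).integral_hasStrictDerivAt 0 z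

lemma hasDerivAt_slopeOf (hp : 1 < p) (ha : 0 < a) (hl : 0 < lam) (z : ℝ) :
    HasDerivAt (slopeOf p a lam) (slopeOf p a lam z * -decayRate p a lam z) z :=
  ((continuous_decayRate hp ha hl).integral_hasStrictDerivAt 0 z).hasDerivAt.neg.exp

lemma slopeOf_pos (z : ℝ) : 0 < slopeOf p a lam z := exp_pos _

lemma slopeOf_le_one (hp : 1 < p) (ha : 0 < a) (hl : 0 < lam) {z : ℝ} (hz : 0 ≤ z) :
    slopeOf p a lam z ≤ 1 := by
  rw [slopeOf, exp_le_one_iff, neg_nonpos]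
  exact intervalIntegral.integral_nonneg hz fun s _ => decayRate_nonneg hp ha hl s

lemma hasDerivAt_mul_slopeOf (hp : 1 < p) (ha : 0 < a) (hl : 0 < lam) {z : ℝ} (hz : 0 ≤ z) :
    HasDerivAt (fun z => z * slopeOf p a lam z) (slopeOf p a lam z * timeDensity p a lam z) z := by
  refine ((hasDerivAt_id z).mul (hasDerivAt_slopeOf hp ha hl z)).congr_deriv ?_
  rw [← one_sub_mul_decayRate hp ha hl hz, id]
  ring

@[simp] lemma timeOf_zero : timeOf p a lam 0 = 0 := intervalIntegral.integral_same

@[simp] lemma slopeOf_zero : slopeOf p a lam 0 = 1 := by simp [slopeOf]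

lemma strictMono_timeOf (hp : 1 < p) (ha : 0 < a) (hl : 0 < lam) :
    StrictMono (timeOf p a lam) :=
  strictMono_of_hasDerivAt_pos (fun z => (hasStrictDerivAt_timeOf hp ha hl z).hasDerivAt)
    (timeDensity_pos hp ha hl)

lemma map_nhds_timeOf (hp : 1 < p) (ha : 0 < a) (hl : 0 < lam) (z : ℝ) :
    map (timeOf p a lam) (𝓝 z) = 𝓝 (timeOf p a lam z) :=
  (hasStrictDerivAt_timeOf hp ha hl z).map_nhds_eq (timeDensity_pos hp ha hl z).ne'

lemma mul_slopeOf_le_timeOf (hp : 1 < p) (ha : 0 < a) (hl : 0 < lam) {z : ℝ} (hz : 0 ≤ z) :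
    z * slopeOf p a lam z ≤ timeOf p a lam z := by
  have hF := fun z => (hasStrictDerivAt_timeOf hp ha hl z).hasDerivAt
  refine image_le_of_deriv_right_le_deriv_boundary (a := 0) (b := z)
    (f := fun z => z * slopeOf p a lam z)
    (fun x hx => (hasDerivAt_mul_slopeOf hp ha hl hx.1).continuousAt.continuousWithinAt)
    (fun x hx => (hasDerivAt_mul_slopeOf hp ha hl hx.1).hasDerivWithinAt) (by simp)
    (fun x _ => (hF x).continuousAt.continuousWithinAt)
    (fun x _ => (hF x).hasDerivWithinAt) (fun x hx => ?_) (right_mem_Icc.2 hz)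
  exact mul_le_of_le_one_left (timeDensity_pos hp ha hl x).le (slopeOf_le_one hp ha hl hx.1)

/-- The slope as a function of time: `slopeOf` transported along `timeOf`, and `0` from the time
`D` on. -/
noncomputable def slopeAt (p a lam D t : ℝ) : ℝ :=
  if t < D then slopeOf p a lam (Function.invFun (timeOf p a lam) t) else 0

variable {D : ℝ}

lemma timeOf_lt (hp : 1 < p) (ha : 0 < a) (hl : 0 < lam)
    (hlim : Tendsto (timeOf p a lam) atTop (𝓝 D)) (z : ℝ) : timeOf p a lam z < D :=
  (strictMono_timeOf hp ha hl (lt_add_one z)).trans_le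
    ((strictMono_timeOf hp ha hl).monotone.ge_of_tendsto hlim _)

lemma exists_timeOf_eq (hp : 1 < p) (ha : 0 < a) (hl : 0 < lam)
    (hlim : Tendsto (timeOf p a lam) atTop (𝓝 D)) {t : ℝ} (ht : t ∈ Ico 0 D) :
    ∃ z, 0 ≤ z ∧ timeOf p a lam z = t := by
  obtain ⟨z, hz⟩ := (hlim.eventually_const_lt ht.2).exists
  have hmono := strictMono_timeOf hp ha hl
  have hz0 : 0 ≤ z := by
    by_contra! h
    have := hmono h
    rw [timeOf_zero] at this
    linarith [ht.1]
  have hcont : Continuous (timeOf p a lam) :=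
    continuous_iff_continuousAt.2 fun z => (hasStrictDerivAt_timeOf hp ha hl z).hasDerivAt.continuousAt
  obtain ⟨y, hy, h⟩ := intermediate_value_Icc hz0 hcont.continuousOn
    (show t ∈ Icc _ _ from ⟨by simpa using ht.1, hz.le⟩)
  exact ⟨y, hy.1, h⟩

lemma slopeAt_timeOf (hp : 1 < p) (ha : 0 < a) (hl : 0 < lam)
    (hlim : Tendsto (timeOf p a lam) atTop (𝓝 D)) (z : ℝ) :
    slopeAt p a lam D (timeOf p a lam z) = slopeOf p a lam z := by
  rw [slopeAt, if_pos (timeOf_lt hp ha hl hlim z),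
    Function.leftInverse_invFun (strictMono_timeOf hp ha hl).injective]

lemma hasDerivAt_slopeAt (hp : 1 < p) (ha : 0 < a) (hl : 0 < lam)
    (hlim : Tendsto (timeOf p a lam) atTop (𝓝 D)) (z : ℝ) :
    HasDerivAt (slopeAt p a lam D)
      (slopeOf p a lam z * -decayRate p a lam z / timeDensity p a lam z) (timeOf p a lam z) := by
  have hmap := map_nhds_timeOf hp ha hl z
  have hleft := Function.leftInverse_invFun (strictMono_timeOf hp ha hl).injective
  have hcont : ContinuousAt (Function.invFun (timeOf p a lam)) (timeOf p a lam z) := by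
    rw [ContinuousAt, ← hmap, tendsto_map'_iff, hleft.comp_eq_id, hleft]
    exact tendsto_id
  have hinv : HasDerivAt (Function.invFun (timeOf p a lam)) (timeDensity p a lam z)⁻¹
      (timeOf p a lam z) := by
    refine HasDerivAt.of_local_left_inverse (f := timeOf p a lam) hcont ?_
      (timeDensity_pos hp ha hl z).ne' ?_
    · rw [hleft]
      exact (hasStrictDerivAt_timeOf hp ha hl z).hasDerivAt
    · rw [← hmap, eventually_map]
      exact Eventually.of_forall fun y => by rw [hleft]
  have hslope := hasDerivAt_slopeOf hp ha hl z
  rw [← hleft z] at hslope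
  refine ((hslope.comp _ hinv).congr_of_eventuallyEq ?_).congr_deriv ?_
  · filter_upwards [Iio_mem_nhds (timeOf_lt hp ha hl hlim z)] with t ht
    rw [slopeAt, if_pos (mem_Iio.1 ht), Function.comp]
  · rw [hleft, div_eq_mul_inv]

lemma slopeAt_nonneg (t : ℝ) : 0 ≤ slopeAt p a lam D t := by
  rw [slopeAt]
  split_ifs
  exacts [(slopeOf_pos _).le, le_rfl]

lemma continuousOn_slopeAt (hp : 1 < p) (ha : 0 < a) (hl : 0 < lam)
    (hlim : Tendsto (timeOf p a lam) atTop (𝓝 D)) :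
    ContinuousOn (slopeAt p a lam D) (Icc 0 D) := by
  intro t ht
  rcases ht.2.lt_or_eq with h | rfl
  · obtain ⟨z, -, rfl⟩ := exists_timeOf_eq hp ha hl hlim ⟨ht.1, h⟩
    exact (hasDerivAt_slopeAt hp ha hl hlim z).continuousAt.continuousWithinAt
  · have h0 : slopeAt p a lam t t = 0 := if_neg (lt_irrefl t)
    have hmono := strictMono_timeOf hp ha hl
    rw [ContinuousWithinAt, h0, Metric.tendsto_nhds]
    intro ε hε
    have hz0 : 0 < (t + 1) / ε := div_pos (by linarith [ht.1]) hε
    filter_upwards [self_mem_nhdsWithin,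
      mem_nhdsWithin_of_mem_nhds (Ioi_mem_nhds (timeOf_lt hp ha hl hlim ((t + 1) / ε)))]
      with s hs hs'
    rw [Real.dist_eq, sub_zero, abs_of_nonneg (slopeAt_nonneg s)]
    rcases hs.2.lt_or_eq with h | rfl
    · obtain ⟨z, hz, rfl⟩ := exists_timeOf_eq hp ha hl hlim ⟨hs.1, h⟩
      rw [slopeAt_timeOf hp ha hl hlim]
      have hlt : (t + 1) / ε < z := hmono.lt_iff_lt.1 hs'
      rw [div_lt_iff₀ hε] at hlt
      have hle := mul_slopeOf_le_timeOf hp ha hl hz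
      by_contra! hcon
      have := mul_le_mul_of_nonneg_left hcon hz
      linarith
    · rwa [h0]

lemma integral_slope_timeOf {φ : ℝ → ℝ} (hp : 1 < p) (ha : 0 < a) (hl : 0 < lam)
    (hφ : Continuous φ)
    (hφ_eq : ∀ z, 0 ≤ z → φ (timeOf p a lam z) = slopeOf p a lam z) {z : ℝ} (hz : 0 ≤ z) :
    ∫ s in 0..timeOf p a lam z, φ s = z * slopeOf p a lam z := by
  have hint : ∀ x ∈ Icc (0 : ℝ) z, HasDerivAt (fun z => ∫ s in 0..timeOf p a lam z, φ s)
      (slopeOf p a lam x * timeDensity p a lam x) x := fun x hx => by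
    rw [← hφ_eq x hx.1]
    exact (hφ.integral_hasStrictDerivAt 0 _).hasDerivAt.comp x
      (hasStrictDerivAt_timeOf hp ha hl x).hasDerivAt
  have hmul : ∀ x ∈ Icc (0 : ℝ) z, HasDerivAt (fun z => z * slopeOf p a lam z)
      (slopeOf p a lam x * timeDensity p a lam x) x :=
    fun x hx => hasDerivAt_mul_slopeOf hp ha hl hx.1
  exact eq_of_has_deriv_right_eq
    (fun x hx => (hint x (Ico_subset_Icc_self hx)).hasDerivWithinAt)
    (fun x hx => (hmul x (Ico_subset_Icc_self hx)).hasDerivWithinAt)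
    (fun x hx => (hint x hx).continuousAt.continuousWithinAt)
    (fun x hx => (hmul x hx).continuousAt.continuousWithinAt) (by simp) z (right_mem_Icc.2 hz)

lemma abs_rpow_sub_two_mul {x : ℝ} (hx : 0 < x) (p : ℝ) : |x| ^ (p - 2) * x = x ^ (p - 1) := by
  rw [abs_of_pos hx, ← rpow_add_one hx.ne']
  ring_nf

lemma exists_solution_of_tendsto_timeOf (hp : 1 < p) (ha : 0 < a) (hl : 0 < lam) (hD : 0 < D)
    (hlim : Tendsto (timeOf p a lam) atTop (𝓝 D)) :
    ∃ w w' : ℝ → ℝ,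
      ContinuousOn w' (Icc 0 D) ∧
      (∀ t ∈ Icc (0:ℝ) D, HasDerivWithinAt w (w' t) (Icc 0 D) t) ∧
      w 0 = 0 ∧ w D = 1 ∧ w' D = 0 ∧
      (∀ t ∈ Ioc (0:ℝ) D, 0 < w t) ∧
      ∃ g : ℝ → ℝ,
        ∀ t ∈ Ioo (0:ℝ) D,
          HasDerivAt (fun s => |w' s| ^ (p - 2) * w' s) (g t) t ∧
          g t + a * (|w' t| ^ (p - 2) * w' t) + lam * (|w t| ^ (p - 2) * w t) = 0 := by
  set φ : ℝ → ℝ := IccExtend hD.le ((Icc 0 D).domRestrict (slopeAt p a lam D)) with hφ_def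
  have hφ : Continuous φ := (continuousOn_slopeAt hp ha hl hlim).domRestrict.Icc_extend'
  have hφ_slope : ∀ t ∈ Icc 0 D, φ t = slopeAt p a lam D t := fun t ht => by
    rw [hφ_def, IccExtend_of_mem _ _ ht, domRestrict_apply]
  have hφ_nonneg : ∀ t, 0 ≤ φ t := fun t => slopeAt_nonneg _
  have hφ_eq : ∀ z, 0 ≤ z → φ (timeOf p a lam z) = slopeOf p a lam z := fun z hz => by
    rw [hφ_slope, slopeAt_timeOf hp ha hl hlim]
    refine ⟨?_, (timeOf_lt hp ha hl hlim z).le⟩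
    simpa using (strictMono_timeOf hp ha hl).monotone hz
  have hφ_zero : φ 0 = 1 := by simpa using hφ_eq 0 le_rfl
  have hpos : ∀ t, 0 < t → 0 < ∫ s in 0..t, φ s := fun t ht =>
    intervalIntegral.integral_pos ht hφ.continuousOn (fun s _ => hφ_nonneg s)
      ⟨0, left_mem_Icc.2 ht.le, by rw [hφ_zero]; exact one_pos⟩
  set c := ∫ s in 0..D, φ s
  have hc : 0 < c := hpos D hD
  refine ⟨fun t => (∫ s in 0..t, φ s) / c, fun t => φ t / c, (hφ.div_const c).continuousOn,
    fun t _ => ((hφ.integral_hasStrictDerivAt 0 t).hasDerivAt.div_const c).hasDerivWithinAt,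
    by simp, div_self hc.ne', ?_, fun t ht => div_pos (hpos t ht.1) hc,
    fun t => -(a * (φ t / c) ^ (p - 1) + lam * ((∫ s in 0..t, φ s) / c) ^ (p - 1)), ?_⟩
  · beta_reduce
    rw [hφ_slope D (right_mem_Icc.2 hD.le), slopeAt, if_neg (lt_irrefl D), zero_div]
  intro t ht
  obtain ⟨z, hz, rfl⟩ := exists_timeOf_eq hp ha hl hlim (Ioo_subset_Ico_self ht)
  have hX : 0 < slopeOf p a lam z / c := div_pos (slopeOf_pos z) hc
  have hderiv : HasDerivAt φ (slopeOf p a lam z * -decayRate p a lam z / timeDensity p a lam z)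
      (timeOf p a lam z) := by
    refine (hasDerivAt_slopeAt hp ha hl hlim z).congr_of_eventuallyEq ?_
    filter_upwards [Icc_mem_nhds ht.1 ht.2] with s hs using hφ_slope s hs
  have hW : (∫ s in 0..timeOf p a lam z, φ s) / c = z * (slopeOf p a lam z / c) := by
    rw [integral_slope_timeOf hp ha hl hφ hφ_eq hz, mul_div_assoc]
  have hX' : φ (timeOf p a lam z) / c = slopeOf p a lam z / c := by rw [hφ_eq z hz]
  have hWpos : 0 < (∫ s in 0..timeOf p a lam z, φ s) / c := div_pos (hpos _ ht.1) hc
  have hXpos : 0 < φ (timeOf p a lam z) / c := hX' ▸ hX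
  have hφ_pos : ∀ᶠ s in 𝓝 (timeOf p a lam z), 0 < φ s / c :=
    (hφ.div_const c).continuousAt.eventually_const_lt hXpos
  constructor
  · have hpow := (hderiv.div_const c).rpow_const (p := p - 1) (Or.inl hXpos.ne')
    refine (hpow.congr_of_eventuallyEq ?_).congr_deriv ?_
    · filter_upwards [hφ_pos] with s hs using abs_rpow_sub_two_mul hs p
    · have hd := timeDensity_denom_pos hp ha hl z
      have hp' : p - 1 ≠ 0 := by linarith
      have hratio : decayRate p a lam z / timeDensity p a lam z
          = (a + lam * z ^ (p - 1)) / (p - 1) := by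
        rw [decayRate, timeDensity, div_div_div_cancel_right₀ hd.ne', abs_of_nonneg hz]
      beta_reduce
      rw [hW, hX', mul_rpow hz hX.le, rpow_sub_one hX.ne' (p - 1)]
      calc _ = -(decayRate p a lam z / timeDensity p a lam z) * (p - 1)
            * (slopeOf p a lam z / c) ^ (p - 1)
            * ((slopeOf p a lam z / c) / (slopeOf p a lam z / c)) := by ring
        _ = _ := by
          rw [hratio, div_self hX.ne', neg_mul, div_mul_cancel₀ _ hp']
          ring
  · simp only [abs_rpow_sub_two_mul hWpos, abs_rpow_sub_two_mul hXpos]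
    ring

lemma timeDensity_anti (hp : 1 < p) (ha : 0 < a) {l₁ l₂ : ℝ} (h₁ : 0 < l₁) (h : l₁ ≤ l₂) (s : ℝ) :
    timeDensity p a l₂ s ≤ timeDensity p a l₁ s := by
  have : 0 ≤ p - 1 := by linarith
  have := timeDensity_denom_pos hp ha h₁ s
  unfold timeDensity
  gcongr

lemma integrableOn_timeDensity (hp : 1 < p) (ha : 0 < a) (hl : 0 < lam) :
    IntegrableOn (timeDensity p a lam) (Ioi 0) := by
  have hcont := continuous_timeDensity hp ha hl
  rw [← Ioc_union_Ioi_eq_Ioi zero_le_one]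
  refine hcont.integrableOn_Ioc.union ?_
  have hpow := (integrableOn_Ioi_rpow_of_lt (show -p < -1 by linarith) one_pos).const_mul
    ((p - 1) / lam)
  refine hpow.mono' hcont.aestronglyMeasurable ?_
  filter_upwards [ae_restrict_mem measurableSet_Ioi] with s hs
  have hs : 0 < s := one_pos.trans hs
  have hp' : 0 < p - 1 := by linarith
  rw [norm_of_nonneg (timeDensity_pos hp ha hl s).le, timeDensity, abs_of_pos hs, rpow_neg hs.le,
    ← div_eq_mul_inv, div_div]
  have : 0 < s ^ p := rpow_pos_of_pos hs p
  gcongr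
  nlinarith

/-- The total time needed for `w / w'` to run through `(0, ∞)`. -/
noncomputable def totalTime (p a lam : ℝ) : ℝ := ∫ s in Ioi 0, timeDensity p a lam s

lemma tendsto_timeOf (hp : 1 < p) (ha : 0 < a) (hl : 0 < lam) :
    Tendsto (timeOf p a lam) atTop (𝓝 (totalTime p a lam)) :=
  intervalIntegral_tendsto_integral_Ioi 0 (integrableOn_timeDensity hp ha hl) tendsto_id

lemma continuousOn_totalTime (hp : 1 < p) (ha : 0 < a) :
    ContinuousOn (totalTime p a) (Ioi 0) := by
  intro l hl
  have hl : 0 < l := hl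
  refine ContinuousAt.continuousWithinAt ?_
  have hev : ∀ᶠ x in 𝓝 l, l / 2 < x := Ioi_mem_nhds (by linarith)
  refine continuousAt_of_dominated (bound := timeDensity p a (l / 2)) ?_ ?_
    (integrableOn_timeDensity hp ha (by linarith)) (Eventually.of_forall fun s => ?_)
  · filter_upwards [hev] with x hx
    exact (continuous_timeDensity hp ha (by linarith)).aestronglyMeasurable
  · filter_upwards [hev] with x hx
    refine Eventually.of_forall fun s => ?_
    rw [norm_of_nonneg (timeDensity_pos hp ha (by linarith) s).le]
    exact timeDensity_anti hp ha (by linarith) hx.le s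
  · exact ContinuousAt.div (by fun_prop) (by fun_prop) (timeDensity_denom_pos hp ha hl s).ne'

lemma tendsto_totalTime_atTop (hp : 1 < p) (ha : 0 < a) :
    Tendsto (totalTime p a) atTop (𝓝 0) := by
  have h := tendsto_integral_filter_of_dominated_convergence
    (μ := volume.restrict (Ioi (0 : ℝ))) (l := atTop) (F := fun l => timeDensity p a l)
    (f := fun _ => 0) (timeDensity p a 1) ?_ ?_ (integrableOn_timeDensity hp ha one_pos) ?_
  · rw [integral_zero] at h
    exact h
  · filter_upwards [eventually_ge_atTop 1] with l hl
    exact (continuous_timeDensity hp ha (by linarith)).aestronglyMeasurable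
  · filter_upwards [eventually_ge_atTop 1] with l hl
    refine Eventually.of_forall fun s => ?_
    rw [norm_of_nonneg (timeDensity_pos hp ha (by linarith) s).le]
    exact timeDensity_anti hp ha one_pos hl s
  · filter_upwards [ae_restrict_mem measurableSet_Ioi] with s hs
    have hs : 0 < |s| ^ p := rpow_pos_of_pos (abs_pos.2 (ne_of_gt hs)) p
    exact (tendsto_atTop_add_const_left _ _ (tendsto_id.atTop_mul_const hs)).const_div_atTop _

lemma exists_le_totalTime (hp : 1 < p) (ha : 0 < a) (D : ℝ) :
    ∃ l, 0 < l ∧ D ≤ totalTime p a l := by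
  have hp' : 0 < p - 1 := by linarith
  have hlog : Tendsto (fun M => (p - 1) / (p + a) * log M) atTop atTop :=
    tendsto_log_atTop.const_mul_atTop (by positivity)
  obtain ⟨M, hMD, hM⟩ := ((hlog.eventually_ge_atTop D).and (eventually_ge_atTop 1)).exists
  have hM0 : 0 < M := one_pos.trans_le hM
  have hl : 0 < M ^ (-p) := rpow_pos_of_pos hM0 _
  refine ⟨M ^ (-p), hl, hMD.trans ?_⟩
  have hcont := continuous_timeDensity hp ha hl
  have hint : (p - 1) / (p + a) * log M = ∫ s in 1..M, (p - 1) / (p + a) * s⁻¹ := by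
    rw [intervalIntegral.integral_const_mul, integral_inv_of_pos one_pos hM0, div_one]
  have hle : ∫ s in 1..M, (p - 1) / (p + a) * s⁻¹ ≤ ∫ s in 1..M, timeDensity p a (M ^ (-p)) s := by
    refine intervalIntegral.integral_mono_on hM ?_ (hcont.intervalIntegrable _ _) fun s hs => ?_
    · refine ContinuousOn.intervalIntegrable (ContinuousOn.mul continuousOn_const ?_)
      refine continuousOn_id.inv₀ fun s hs => ?_
      rw [uIcc_of_le hM] at hs
      exact (one_pos.trans_le hs.1).ne'
    · have hs0 : 0 < s := one_pos.trans_le hs.1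
      have hd := timeDensity_denom_pos hp ha hl s
      have hsp : M ^ (-p) * s ^ p ≤ 1 := by
        rw [rpow_neg hM0.le, inv_mul_le_one₀ (rpow_pos_of_pos hM0 p)]
        exact rpow_le_rpow hs0.le hs.2 (by linarith)
      rw [← div_eq_mul_inv, div_div, timeDensity]
      rw [abs_of_pos hs0] at hd ⊢
      gcongr
      nlinarith [hs.1]
  have hmono := (strictMono_timeOf hp ha hl).monotone
  have hsub : ∫ s in 1..M, timeDensity p a (M ^ (-p)) s
      = timeOf p a (M ^ (-p)) M - timeOf p a (M ^ (-p)) 1 :=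
    (intervalIntegral.integral_interval_sub_left (hcont.intervalIntegrable _ _)
      (hcont.intervalIntegrable _ _)).symm
  have h1 : 0 ≤ timeOf p a (M ^ (-p)) 1 := by simpa using hmono zero_le_one
  have hM_le := hmono.ge_of_tendsto (tendsto_timeOf hp ha hl) M
  linarith

lemma exists_totalTime_eq (hp : 1 < p) (ha : 0 < a) (hD : 0 < D) :
    ∃ l, 0 < l ∧ totalTime p a l = D := by
  obtain ⟨l₁, hl₁, h₁⟩ := exists_le_totalTime hp ha D
  obtain ⟨l₂, h₂, hl₂⟩ := (((tendsto_totalTime_atTop hp ha).eventually_le_const hD).and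
    (eventually_gt_atTop 0)).exists
  exact isPreconnected_Ioi.intermediate_value hl₂ hl₁ (continuousOn_totalTime hp ha) ⟨h₂, h₁⟩

end


/-- for `p > 1`, `a > 0` and `D > 0`, there exist `λ > 0` and a continuously
differentiable `w : [0,D] → ℝ` with `w(0) = 0`, `w(D) = 1`, `w'(D) = 0`, `w > 0` on `(0,D]`,
such that `t ↦ |w'(t)|^(p-2) w'(t)` is differentiable on `(0,D)` and
`(|w'|^(p-2) w')' + a |w'|^(p-2) w' + λ |w|^(p-2) w = 0` on `(0,D)`. -/
theorem stmt6 (p a D : ℝ) (hp : 1 < p) (ha : 0 < a) (hD : 0 < D) :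
    ∃ (lam : ℝ) (w w' : ℝ → ℝ),
      0 < lam ∧
      ContinuousOn w' (Icc 0 D) ∧
      (∀ t ∈ Icc (0:ℝ) D, HasDerivWithinAt w (w' t) (Icc 0 D) t) ∧
      w 0 = 0 ∧ w D = 1 ∧ w' D = 0 ∧
      (∀ t ∈ Ioc (0:ℝ) D, 0 < w t) ∧
      ∃ g : ℝ → ℝ,
        ∀ t ∈ Ioo (0:ℝ) D,
          HasDerivAt (fun s => |w' s| ^ (p - 2) * w' s) (g t) t ∧
          g t + a * (|w' t| ^ (p - 2) * w' t) + lam * (|w t| ^ (p - 2) * w t) = 0 := by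
  obtain ⟨lam, hl, rfl⟩ := exists_totalTime_eq hp ha hD
  obtain ⟨w, w', h⟩ := exists_solution_of_tendsto_timeOf hp ha hl hD (tendsto_timeOf hp ha hl)
  exact ⟨lam, w, w', hl, h⟩
end

section
/- Let p > 1 and β > 0, and for each D > 0 let α(D) be the unique positive solution of ∫₀^{π_p/2} dφ / (α + β·cos_p(φ)^{p−1}·sin_p(φ)) = D, and set λ̄(D) = (p−1)·α(D)^p. Then there exist constants C > 0 and D₀ > 0 such that for all 0 < D < D₀, |λ̄(D) − (p−1)·(π_p/(2D))^p| ≤ C·D^{1−p}. -/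
open Real MeasureTheory Set

/-- The tangent line inequality for `x ^ p`, written as an upper bound for a difference. -/
theorem rpow_sub_rpow_le {p a x : ℝ} (hp : 1 ≤ p) (ha : 0 ≤ a) (hx : 0 < x) :
    x ^ p - a ^ p ≤ p * x ^ (p - 1) * (x - a) := by
  have hax : 0 ≤ a / x := by positivity
  have h := one_add_mul_self_le_rpow_one_add (s := a / x - 1) (by linarith) hp
  rw [add_sub_cancel, div_rpow ha hx.le, le_div_iff₀ (by positivity)] at h
  have hxp : x ^ p = x ^ (p - 1) * x := by
    rw [← rpow_add_one hx.ne', sub_add_cancel]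
  have hid : (1 + p * (a / x - 1)) * x ^ p = x ^ p - p * x ^ (p - 1) * (x - a) := by
    rw [hxp]
    field_simp
    ring
  linarith

/-- For `c` with values in `[0, β]`, a nonzero integral `D = ∫₀ᵀ dφ / (a + c φ)` places `a`
between `T / D - β` and `T / D`. -/
theorem mem_Icc_of_integral_one_div_add_eq {a β T D : ℝ} {c : ℝ → ℝ} (ha : 0 < a) (hT : 0 ≤ T)
    (hD : 0 < D) (hc : ∀ φ ∈ Icc 0 T, c φ ∈ Icc 0 β)
    (h : ∫ φ in (0:ℝ)..T, 1 / (a + c φ) = D) : a ∈ Icc (T / D - β) (T / D) := by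
  have hβ : 0 ≤ β := (hc 0 ⟨le_rfl, hT⟩).1.trans (hc 0 ⟨le_rfl, hT⟩).2
  have hint : IntervalIntegrable (fun φ => 1 / (a + c φ)) volume 0 T := by
    by_contra hn
    rw [intervalIntegral.integral_undef hn] at h
    exact hD.ne h
  have hupper : D ≤ T / a := by
    have := intervalIntegral.integral_mono_on hT hint
      (intervalIntegrable_const (c := 1 / a)) fun φ hφ =>
        one_div_le_one_div_of_le ha (le_add_of_nonneg_right (hc φ hφ).1)
    rw [h, intervalIntegral.integral_const, smul_eq_mul, sub_zero, mul_one_div] at this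
    exact this
  have hlower : T / (a + β) ≤ D := by
    have := intervalIntegral.integral_mono_on hT
      (intervalIntegrable_const (c := 1 / (a + β))) hint fun φ hφ =>
        one_div_le_one_div_of_le (add_pos_of_pos_of_nonneg ha (hc φ hφ).1)
          (add_le_add_right (hc φ hφ).2 a)
    rw [h, intervalIntegral.integral_const, smul_eq_mul, sub_zero, mul_one_div] at this
    exact this
  rw [le_div_iff₀ ha] at hupper
  rw [div_le_iff₀ (by positivity)] at hlower
  refine ⟨?_, ?_⟩
  · rw [sub_le_iff_le_add, div_le_iff₀ hD]
    linarith
  · rw [le_div_iff₀ hD]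
    linarith

theorem piP_nonneg {p : ℝ} (hp : 0 ≤ p) : 0 ≤ piP p := by
  refine mul_nonneg zero_le_two (intervalIntegral.integral_nonneg zero_le_one fun s hs => ?_)
  exact rpow_nonneg (sub_nonneg.2 (rpow_le_one hs.1 hs.2 hp)) _

/-- The perturbation `β cos_p ^ (p - 1) sin_p` takes values in `[0, β]`. -/
theorem mul_cos_rpow_mul_mem_Icc {p β s : ℝ} (hp : 1 ≤ p) (hβ : 0 ≤ β) (hs : s ∈ Icc (0:ℝ) 1) :
    β * ((1 - s ^ p) ^ (1 / p)) ^ (p - 1) * s ∈ Icc 0 β := by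
  have hp0 : 0 ≤ p := zero_le_one.trans hp
  have h0 : 0 ≤ 1 - s ^ p := sub_nonneg.2 (rpow_le_one hs.1 hs.2 hp0)
  have h1 : 1 - s ^ p ≤ 1 := sub_le_self _ (rpow_nonneg hs.1 p)
  have hc0 : 0 ≤ (1 - s ^ p) ^ (1 / p) := rpow_nonneg h0 _
  have hd0 : 0 ≤ ((1 - s ^ p) ^ (1 / p)) ^ (p - 1) := rpow_nonneg hc0 _
  have hd1 : ((1 - s ^ p) ^ (1 / p)) ^ (p - 1) ≤ 1 :=
    rpow_le_one hc0 (rpow_le_one h0 h1 (by positivity)) (sub_nonneg.2 hp)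
  refine ⟨mul_nonneg (mul_nonneg hβ hd0) hs.1, ?_⟩
  rw [mul_assoc]
  exact mul_le_of_le_one_right hβ (mul_le_one₀ hd1 hs.1 hs.2)

/-- for `p > 1` and `β > 0`, letting `α(D)` be the unique positive solution
of `∫₀^{π_p/2} dφ/(α + β cos_p(φ)^(p-1) sin_p(φ)) = D` and `λ̄(D) = (p-1) α(D)^p`, there
are `C > 0` and `D₀ > 0` such that for all `0 < D < D₀`,
`|λ̄(D) - (p-1)(π_p/(2D))^p| ≤ C · D^(1-p)`. -/
theorem stmt8 (p β : ℝ) (hp : 1 < p) (hβ : 0 < β) (sinp : ℝ → ℝ)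
    (hmaps : ∀ t ∈ Icc (0:ℝ) (piP p / 2), sinp t ∈ Icc (0:ℝ) 1)
    (hleft : ∀ x ∈ Icc (0:ℝ) 1, sinp (arcsinP p x) = x)
    (hright : ∀ t ∈ Icc (0:ℝ) (piP p / 2), arcsinP p (sinp t) = t)
    (α : ℝ → ℝ)
    (hα : ∀ D : ℝ, 0 < D → 0 < α D ∧
      (∫ φ in (0:ℝ)..(piP p / 2),
        1 / (α D + β * ((1 - sinp φ ^ p) ^ (1 / p)) ^ (p - 1) * sinp φ)) = D) :
    ∃ C > (0:ℝ), ∃ D₀ > (0:ℝ), ∀ D : ℝ, 0 < D → D < D₀ →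
      |(p - 1) * α D ^ p - (p - 1) * (piP p / (2 * D)) ^ p| ≤ C * D ^ (1 - p) := by
  have hT0 : 0 ≤ piP p / 2 := div_nonneg (piP_nonneg (by linarith)) zero_le_two
  have hT : 0 < piP p / 2 := by
    refine hT0.lt_of_ne fun h => ?_
    have := (hα 1 one_pos).2
    rw [← h, intervalIntegral.integral_same] at this
    exact zero_ne_one this
  have hp1 : 0 < p - 1 := sub_pos.2 hp
  refine ⟨(p - 1) * (p * (piP p / 2) ^ (p - 1) * β), by positivity, 1, one_pos, ?_⟩
  intro D hD _
  obtain ⟨ha, hI⟩ := hα D hD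
  obtain ⟨hl, hu⟩ := mem_Icc_of_integral_one_div_add_eq ha hT0 hD
    (fun φ hφ => mul_cos_rpow_mul_mem_Icc hp.le hβ.le (hmaps φ hφ)) hI
  have hx : 0 < piP p / 2 / D := div_pos hT hD
  have hmono : α D ^ p ≤ (piP p / 2 / D) ^ p := rpow_le_rpow ha.le hu (by linarith)
  have hpow : (piP p / 2 / D) ^ (p - 1) = (piP p / 2) ^ (p - 1) * D ^ (1 - p) := by
    rw [div_rpow hT0 hD.le, div_eq_mul_inv, ← rpow_neg hD.le, neg_sub]
  rw [← div_div, ← mul_sub, abs_mul, abs_of_pos hp1, abs_sub_comm,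
    abs_of_nonneg (sub_nonneg.2 hmono), mul_assoc]
  refine mul_le_mul_of_nonneg_left ?_ hp1.le
  calc (piP p / 2 / D) ^ p - α D ^ p
      ≤ p * (piP p / 2 / D) ^ (p - 1) * (piP p / 2 / D - α D) := rpow_sub_rpow_le hp.le ha.le hx
    _ ≤ p * (piP p / 2 / D) ^ (p - 1) * β := by
        refine mul_le_mul_of_nonneg_left (by linarith) (by positivity)
    _ = p * (piP p / 2) ^ (p - 1) * β * D ^ (1 - p) := by rw [hpow]; ring
end

section
/- Let p > 1. There exist constants C > 0 and ε ∈ (0, π_p/2) such that for all φ ∈ (0, ε), |cos_p(φ)^{p−1}·sin_p(φ) − φ| ≤ C·φ^{p+1}. -/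
open Real MeasureTheory Set

theorem one_le_arcsinP_integrand {p s : ℝ} (hp : 1 < p) (h0 : 0 ≤ s) (h1 : s < 1) :
    1 ≤ (1 - s ^ p) ^ (-1 / p) := by
  have hsp : s ^ p < 1 := rpow_lt_one h0 h1 (by linarith)
  have hsp0 : 0 ≤ s ^ p := rpow_nonneg h0 p
  apply one_le_rpow_of_pos_of_le_one_of_nonpos (by linarith) (by linarith)
  exact div_nonpos_of_nonpos_of_nonneg (by norm_num) (by linarith)

theorem self_le_arcsinP {p x : ℝ} (hp : 1 < p) (hx0 : 0 ≤ x) (hx1 : x ≤ 1)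
    (hint : IntervalIntegrable (fun s : ℝ => (1 - s ^ p) ^ (-1 / p)) volume 0 1) :
    x ≤ arcsinP p x := by
  have hx : IntervalIntegrable (fun s : ℝ => (1 - s ^ p) ^ (-1 / p)) volume 0 x := by
    apply hint.mono_set
    rw [uIcc_of_le hx0, uIcc_of_le zero_le_one]
    exact Icc_subset_Icc_right hx1
  calc x = ∫ _ in (0:ℝ)..x, (1:ℝ) := by simp
    _ ≤ arcsinP p x :=
      intervalIntegral.integral_mono_on_of_le_Ioo hx0 intervalIntegrable_const hx
        fun s hs => one_le_arcsinP_integrand hp hs.1.le (hs.2.trans_le hx1)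

theorem arcsinP_le_mul {p x : ℝ} (hp : 1 < p) (hx0 : 0 ≤ x) (hx1 : x < 1)
    (hint : IntervalIntegrable (fun s : ℝ => (1 - s ^ p) ^ (-1 / p)) volume 0 1) :
    arcsinP p x ≤ x * (1 - x ^ p) ^ (-1 / p) := by
  have hx : IntervalIntegrable (fun s : ℝ => (1 - s ^ p) ^ (-1 / p)) volume 0 x := by
    apply hint.mono_set
    rw [uIcc_of_le hx0, uIcc_of_le zero_le_one]
    exact Icc_subset_Icc_right hx1.le
  have hxp : x ^ p < 1 := rpow_lt_one hx0 hx1 (by linarith)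
  calc arcsinP p x ≤ ∫ _ in (0:ℝ)..x, (1 - x ^ p) ^ (-1 / p) := by
        refine intervalIntegral.integral_mono_on_of_le_Ioo hx0 hx intervalIntegrable_const
          fun s hs => ?_
        have hsx : s ^ p ≤ x ^ p := rpow_le_rpow hs.1.le hs.2.le (by linarith)
        apply rpow_le_rpow_of_nonpos (by linarith) (by linarith)
        exact div_nonpos_of_nonpos_of_nonneg (by norm_num) (by linarith)
    _ = x * (1 - x ^ p) ^ (-1 / p) := by simp

/-- for `p > 1` there are `C > 0` and `ε ∈ (0, π_p/2)` such that for all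
`φ ∈ (0, ε)`, `|cos_p(φ)^(p-1) sin_p(φ) - φ| ≤ C φ^(p+1)`, where
`cos_p(t) = (1 - sin_p(t)^p)^(1/p)`. -/
theorem stmt10 (p : ℝ) (hp : 1 < p) (sinp : ℝ → ℝ)
    (hmaps : ∀ t ∈ Icc (0:ℝ) (piP p / 2), sinp t ∈ Icc (0:ℝ) 1)
    (hleft : ∀ x ∈ Icc (0:ℝ) 1, sinp (arcsinP p x) = x)
    (hright : ∀ t ∈ Icc (0:ℝ) (piP p / 2), arcsinP p (sinp t) = t) :
    ∃ C > (0:ℝ), ∃ ε : ℝ, 0 < ε ∧ ε < piP p / 2 ∧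
      ∀ φ ∈ Ioo (0:ℝ) ε,
        |((1 - sinp φ ^ p) ^ (1 / p)) ^ (p - 1) * sinp φ - φ| ≤ C * φ ^ (p + 1) := by
  have hp0 : 0 < p := by linarith
  have hint : IntervalIntegrable (fun s : ℝ => (1 - s ^ p) ^ (-1 / p)) volume 0 1 := by
    by_contra h
    have h1 : arcsinP p 1 = 0 := intervalIntegral.integral_undef h
    have h0 : arcsinP p 0 = 0 := intervalIntegral.integral_same
    have e1 := hleft 1 (by simp)
    have e0 := hleft 0 (by simp)
    rw [h1] at e1
    rw [h0] at e0
    linarith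
  have hpi : 1 ≤ piP p / 2 := by
    have := self_le_arcsinP hp zero_le_one le_rfl hint
    unfold piP
    linarith
  refine ⟨2, two_pos, 1 / 2, by norm_num, by linarith, fun φ hφ => ?_⟩
  have hφI : φ ∈ Icc (0:ℝ) (piP p / 2) := ⟨hφ.1.le, by linarith [hφ.2]⟩
  obtain ⟨hx0, hx1⟩ := hmaps φ hφI
  have hφx := hright φ hφI
  set x := sinp φ
  have hxφ : x ≤ φ := hφx ▸ self_le_arcsinP hp hx0 hx1 hint
  have hx2 : x < 1 / 2 := hxφ.trans_lt hφ.2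
  have hup : φ ≤ x * (1 - x ^ p) ^ (-1 / p) :=
    hφx ▸ arcsinP_le_mul hp hx0 (by linarith) hint
  have hxp0 : 0 ≤ x ^ p := rpow_nonneg hx0 p
  have hxp : x ^ p ≤ x := rpow_le_self_of_le_one hx0 hx1 hp.le
  set c := (1 - x ^ p) ^ (1 / p) with hc
  have hc0 : 0 < c := rpow_pos_of_pos (by linarith) _
  have hcp : c ^ p = 1 - x ^ p := by
    rw [hc, ← rpow_mul (by linarith), one_div_mul_cancel hp0.ne', rpow_one]
  have hc1 : c ≤ 1 := rpow_le_one (by linarith) (by linarith) (by positivity)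
  have hc2 : 1 / 2 ≤ c := by
    have : c ^ p ≤ c := rpow_le_self_of_le_one hc0.le hc1 hp.le
    linarith
  have hinv : (1 - x ^ p) ^ (-1 / p) = c⁻¹ := by
    rw [neg_div, rpow_neg (by linarith)]
  rw [hinv] at hup
  have hcpow : c ^ (p - 1) = (1 - x ^ p) * c⁻¹ := by
    rw [rpow_sub_one hc0.ne', hcp, div_eq_mul_inv]
  have hcle : c ^ (p - 1) ≤ 1 := rpow_le_one hc0.le hc1 (by linarith)
  have hcinv : c⁻¹ ≤ 2 := by
    rw [inv_le_comm₀ hc0 two_pos]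
    linarith
  have hpow : x * x ^ p ≤ φ ^ (p + 1) := by
    rw [rpow_add_one hφ.1.ne', mul_comm]
    exact mul_le_mul (rpow_le_rpow hx0 hxφ hp0.le) hxφ hx0 (rpow_nonneg hφ.1.le p)
  rw [abs_sub_comm, abs_of_nonneg (by linarith [mul_le_of_le_one_left hx0 hcle])]
  calc φ - c ^ (p - 1) * x ≤ x * c⁻¹ - (1 - x ^ p) * c⁻¹ * x := by rw [hcpow]; linarith
    _ = c⁻¹ * (x * x ^ p) := by ring
    _ ≤ 2 * φ ^ (p + 1) := mul_le_mul hcinv hpow (by positivity) two_pos.le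
end

section
/- Let p > 1 and β > 0. For α > 0, define h_α : [0, π_p/2] → ℝ by h_α(φ) = 1/(α + β·φ) for φ ∈ [0, π_p/4) and h_α(φ) = 1/(α + β·(p−1)·(π_p/2 − φ)) for φ ∈ [π_p/4, π_p/2]. Then there exists a constant C > 0 such that for all α ∈ (0,1], |∫₀^{π_p/2} dφ/(α + β·cos_p(φ)^{p−1}·sin_p(φ)) − ∫₀^{π_p/2} h_α(φ) dφ| ≤ C. -/
open Real MeasureTheory Set

lemma intervalIntegrable_one_sub_rpow {p a b : ℝ} (hp : 1 < p) (ha : a ∈ Icc (0:ℝ) 1)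
    (hb : b ∈ Icc (0:ℝ) 1) :
    IntervalIntegrable (fun s : ℝ => (1 - s ^ p) ^ (-1 / p)) volume a b := by
  have hp0 : 0 < p := by linarith
  have key : IntervalIntegrable (fun s : ℝ => (1 - s ^ p) ^ (-1 / p)) volume 0 1 := by
    have h1 : IntervalIntegrable (fun s : ℝ => (1 - s) ^ (-1 / p)) volume 0 1 := by
      have hr : -1 < -1 / p := by
        rw [lt_div_iff₀ hp0]; linarith
      have h := (intervalIntegral.intervalIntegrable_rpow' (a := 1) (b := 0) hr).comp_sub_left 1
      simpa using h
    refine h1.mono_fun' (Measurable.aestronglyMeasurable (by fun_prop)) ?_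
    rw [uIoc_of_le zero_le_one, ← restrict_Ioo_eq_restrict_Ioc]
    refine (ae_restrict_mem measurableSet_Ioo).mono fun s hs => ?_
    have h2 : s ^ p ≤ s := by
      simpa using rpow_le_rpow_of_exponent_ge hs.1 hs.2.le hp.le
    have h3 : 0 < 1 - s := by linarith [hs.2]
    refine (norm_of_nonneg (rpow_nonneg (by linarith) _)).trans_le ?_
    exact rpow_le_rpow_of_nonpos h3 (by linarith) (div_nonpos_of_nonpos_of_nonneg (by simp) hp0.le)
  refine key.mono_set ?_
  rw [uIcc_of_le zero_le_one]
  exact uIcc_subset_Icc ha hb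

lemma arcsinP_sub_arcsinP {p x y : ℝ} (hp : 1 < p) (hx : x ∈ Icc (0:ℝ) 1)
    (hy : y ∈ Icc (0:ℝ) 1) :
    arcsinP p y - arcsinP p x = ∫ s in x..y, (1 - s ^ p) ^ (-1 / p) :=
  intervalIntegral.integral_interval_sub_left
    (intervalIntegrable_one_sub_rpow hp (by simp) hy)
    (intervalIntegrable_one_sub_rpow hp (by simp) hx)

lemma sub_le_arcsinP_sub {p x y : ℝ} (hp : 1 < p) (hx : 0 ≤ x) (hxy : x ≤ y) (hy : y ≤ 1) :
    y - x ≤ arcsinP p y - arcsinP p x := by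
  rw [arcsinP_sub_arcsinP hp ⟨hx, hxy.trans hy⟩ ⟨hx.trans hxy, hy⟩]
  have h := intervalIntegral.integral_mono_on_of_le_Ioo (μ := volume) (f := fun _ => (1:ℝ)) hxy
    (by simp)
    (intervalIntegrable_one_sub_rpow hp ⟨hx, hxy.trans hy⟩ ⟨hx.trans hxy, hy⟩) (fun s hs => ?_)
  · simpa using h
  have hs0 : 0 < s := hx.trans_lt hs.1
  have hs1 : s < 1 := hs.2.trans_le hy
  have h1 : 0 < s ^ p := rpow_pos_of_pos hs0 _
  have h2 : s ^ p < 1 := rpow_lt_one hs0.le hs1 (by linarith)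
  exact one_le_rpow_of_pos_of_le_one_of_nonpos (by linarith) (by linarith)
    (div_nonpos_of_nonpos_of_nonneg (by simp) (by linarith))

lemma arcsinP_zero (p : ℝ) : arcsinP p 0 = 0 := by simp [arcsinP]

lemma strictMonoOn_arcsinP {p : ℝ} (hp : 1 < p) : StrictMonoOn (arcsinP p) (Icc 0 1) := by
  intro x hx y hy hxy
  linarith [sub_le_arcsinP_sub hp hx.1 hxy.le hy.2]

lemma arcsinP_mul_le {p x : ℝ} (hp : 1 < p) (hx : 0 ≤ x) (hx1 : x < 1) :
    arcsinP p x * (1 - x ^ p) ^ (1 / p) ≤ x := by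
  have hxp : x ^ p < 1 := rpow_lt_one hx hx1 (by linarith)
  have hle : arcsinP p x ≤ x * (1 - x ^ p) ^ (-1 / p) := by
    have h := intervalIntegral.integral_mono_on (μ := volume)
      (f := fun s : ℝ => (1 - s ^ p) ^ (-1 / p)) (g := fun _ => (1 - x ^ p) ^ (-1 / p)) hx
      (intervalIntegrable_one_sub_rpow hp (by simp) ⟨hx, hx1.le⟩) (by simp) (fun s hs => ?_)
    · simpa [arcsinP] using h
    have h1 : s ^ p ≤ x ^ p := rpow_le_rpow hs.1 hs.2 (by linarith)
    exact rpow_le_rpow_of_nonpos (by linarith) (by linarith)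
      (div_nonpos_of_nonpos_of_nonneg (by simp) (by linarith))
  have hw : 0 < (1 - x ^ p) ^ (1 / p) := rpow_pos_of_pos (by linarith) _
  calc arcsinP p x * (1 - x ^ p) ^ (1 / p)
      ≤ x * (1 - x ^ p) ^ (-1 / p) * (1 - x ^ p) ^ (1 / p) := by gcongr
    _ = x := by
      rw [mul_assoc, ← rpow_add (by linarith), show -1 / p + 1 / p = 0 by ring, rpow_zero, mul_one]

lemma integral_rpow_mul_one_sub_rpow {p x : ℝ} (hp : 1 < p) (hx : x ∈ Icc (0:ℝ) 1) :
    IntervalIntegrable (fun s : ℝ => (p - 1) * s ^ (p - 1) * (1 - s ^ p) ^ (-1 / p)) volume x 1 ∧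
    ∫ s in x..1, (p - 1) * s ^ (p - 1) * (1 - s ^ p) ^ (-1 / p)
      = (1 - x ^ p) ^ ((p - 1) / p) := by
  have hp0 : 0 < p := by linarith
  have hint : IntervalIntegrable
      (fun s : ℝ => (p - 1) * s ^ (p - 1) * (1 - s ^ p) ^ (-1 / p)) volume x 1 := by
    refine (intervalIntegrable_one_sub_rpow hp hx (by simp)).continuousOn_mul ?_
    exact continuousOn_const.mul (continuousOn_id.rpow_const fun _ _ => Or.inr (by linarith))
  refine ⟨hint, ?_⟩
  have hq : 0 < (p - 1) / p := div_pos (by linarith) hp0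
  have h := intervalIntegral.integral_eq_sub_of_hasDerivAt_of_le
    (f := fun s : ℝ => -(1 - s ^ p) ^ ((p - 1) / p)) hx.2 ?_ ?_ hint
  · rw [h]
    simp [zero_rpow hq.ne']
  · refine ContinuousOn.neg (ContinuousOn.rpow_const ?_ fun _ _ => Or.inr hq.le)
    exact continuousOn_const.sub (continuousOn_id.rpow_const fun _ _ => Or.inr hp0.le)
  · intro s hs
    have hs0 : 0 < s := hx.1.trans_lt hs.1
    have hsp : s ^ p < 1 := rpow_lt_one hs0.le hs.2 hp0
    have h1 := ((((hasDerivAt_id s).rpow_const (p := p) (Or.inr hp.le)).const_sub 1).rpow_const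
      (p := (p - 1) / p) (Or.inl (by simp only [id]; linarith))).neg
    refine h1.congr_deriv ?_
    rw [show (p - 1) / p - 1 = -1 / p by field_simp; ring]
    simp only [id]
    field_simp

lemma mul_arcsinP_one_sub_bounds {p x : ℝ} (hp : 1 < p) (hx : x ∈ Icc (0:ℝ) 1) :
    x ^ (p - 1) * ((p - 1) * (arcsinP p 1 - arcsinP p x)) ≤ (1 - x ^ p) ^ ((p - 1) / p) ∧
    (1 - x ^ p) ^ ((p - 1) / p) ≤ (p - 1) * (arcsinP p 1 - arcsinP p x) := by
  obtain ⟨hint, heq⟩ := integral_rpow_mul_one_sub_rpow hp hx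
  have hint' := intervalIntegrable_one_sub_rpow hp hx (b := 1) (by simp)
  rw [← heq, arcsinP_sub_arcsinP hp hx (by simp), ← mul_assoc,
    ← intervalIntegral.integral_const_mul, ← intervalIntegral.integral_const_mul]
  have hp1 : 0 ≤ p - 1 := by linarith
  have hw : ∀ s ∈ Icc x 1, 0 ≤ (1 - s ^ p) ^ (-1 / p) := fun s hs =>
    rpow_nonneg (by linarith [rpow_le_one (hx.1.trans hs.1) hs.2 (by linarith : 0 ≤ p)]) _
  constructor
  · refine intervalIntegral.integral_mono_on hx.2 (hint'.const_mul _) hint fun s hs => ?_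
    refine mul_le_mul_of_nonneg_right ?_ (hw s hs)
    rw [mul_comm]
    exact mul_le_mul_of_nonneg_left (rpow_le_rpow hx.1 hs.1 hp1) hp1
  · refine intervalIntegral.integral_mono_on hx.2 hint (hint'.const_mul _) fun s hs => ?_
    refine mul_le_mul_of_nonneg_right ?_ (hw s hs)
    exact mul_le_of_le_one_right hp1 (rpow_le_one (hx.1.trans hs.1) hs.2 hp1)

lemma abs_one_div_sub_one_div_le {α β a b K : ℝ} (hα : 0 < α) (hβ : 0 < β) (ha : 0 ≤ a)
    (hb : 0 ≤ b) (hK : 0 ≤ K) (h : |b - a| ≤ K * (a * b)) :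
    |1 / (α + β * a) - 1 / (α + β * b)| ≤ K / β := by
  have h1 : 0 < α + β * a := by positivity
  have h2 : 0 < α + β * b := by positivity
  rw [div_sub_div _ _ h1.ne' h2.ne', abs_div, abs_of_pos (mul_pos h1 h2),
    div_le_div_iff₀ (mul_pos h1 h2) hβ,
    show 1 * (α + β * b) - (α + β * a) * 1 = β * (b - a) by ring, abs_mul, abs_of_pos hβ]
  have h3 : β ^ 2 * (a * b) ≤ (α + β * a) * (α + β * b) := by
    have : 0 ≤ α * (α + β * a + β * b) := by positivity
    nlinarith
  calc β * |b - a| * β = β ^ 2 * |b - a| := by ring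
    _ ≤ β ^ 2 * (K * (a * b)) := by gcongr
    _ = K * (β ^ 2 * (a * b)) := by ring
    _ ≤ _ := by gcongr

lemma rpow_one_div_mul_rpow_sub_one {p y : ℝ} (hp : 1 < p) (hy : 0 ≤ y) :
    y ^ (1 / p) * (y ^ (1 / p)) ^ (p - 1) = y := by
  have hp0 : p ≠ 0 := by linarith
  rw [← rpow_mul hy, ← rpow_add_of_nonneg hy (by positivity)
    (mul_nonneg (by positivity) (by linarith)),
    show 1 / p + 1 / p * (p - 1) = 1 by field_simp; ring, rpow_one]

lemma abs_arcsinP_sub_le {p x x₀ : ℝ} (hp : 1 < p) (hx : 0 ≤ x) (hxx : x ≤ x₀) (hx₀ : x₀ < 1) :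
    |arcsinP p x - ((1 - x ^ p) ^ (1 / p)) ^ (p - 1) * x|
      ≤ 1 / (1 - x₀ ^ p) * (((1 - x ^ p) ^ (1 / p)) ^ (p - 1) * x * arcsinP p x) := by
  have hx1 : x < 1 := hxx.trans_lt hx₀
  have hp0 : 0 < p := by linarith
  have hφw := arcsinP_mul_le hp hx hx1
  have hxφ : x ≤ arcsinP p x := by
    simpa [arcsinP_zero] using sub_le_arcsinP_sub hp le_rfl hx hx1.le
  have hxp : x ^ p < 1 := rpow_lt_one hx hx1 hp0
  have hxp0 : 0 ≤ x ^ p := rpow_nonneg hx p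
  have hxpx : x ^ p ≤ x := by
    simpa using rpow_le_rpow_of_exponent_ge_of_imp hx hx1.le hp.le fun _ h => absurd h hp0.ne'
  have hx0p : x₀ ^ p < 1 := rpow_lt_one (hx.trans hxx) hx₀ hp0
  have hxx0 : x ^ p ≤ x₀ ^ p := rpow_le_rpow hx hxx hp0.le
  have hwW := rpow_one_div_mul_rpow_sub_one hp (y := 1 - x ^ p) (by linarith)
  have hw0 : 0 < (1 - x ^ p) ^ (1 / p) := rpow_pos_of_pos (by linarith) _
  have hw1 : (1 - x ^ p) ^ (1 / p) ≤ 1 := rpow_le_one (by linarith) (by linarith) (by positivity)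
  have hW1 : ((1 - x ^ p) ^ (1 / p)) ^ (p - 1) ≤ 1 := rpow_le_one hw0.le hw1 (by linarith)
  set w := (1 - x ^ p) ^ (1 / p)
  set W := w ^ (p - 1)
  set φ := arcsinP p x
  have hφ : 0 ≤ φ := hx.trans hxφ
  have hWx : W * x ≤ x := mul_le_of_le_one_left hx hW1
  rw [abs_of_nonneg (by linarith), div_mul_eq_mul_div, one_mul, le_div_iff₀ (by linarith)]
  refine le_of_mul_le_mul_left ?_ hw0
  calc w * ((φ - W * x) * (1 - x₀ ^ p)) = (φ * w - (w * W) * x) * (1 - x₀ ^ p) := by ring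
    _ ≤ (x - (1 - x ^ p) * x) * (1 - x₀ ^ p) := by
      rw [hwW]
      exact mul_le_mul_of_nonneg_right (by linarith) (by linarith)
    _ = x * x ^ p * (1 - x₀ ^ p) := by ring
    _ ≤ x * φ * (1 - x ^ p) := by
      have : 0 ≤ 1 - x₀ ^ p := by linarith
      gcongr
      exact hxpx.trans hxφ
    _ = w * (W * x * φ) := by rw [← hwW]; ring

lemma abs_mul_arcsinP_one_sub_le {p x x₀ : ℝ} (hp : 1 < p) (hx₀ : 0 < x₀) (hxx : x₀ ≤ x)
    (hx1 : x ≤ 1) :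
    |(p - 1) * (arcsinP p 1 - arcsinP p x) - ((1 - x ^ p) ^ (1 / p)) ^ (p - 1) * x|
      ≤ 1 / x₀ * (((1 - x ^ p) ^ (1 / p)) ^ (p - 1) * x *
        ((p - 1) * (arcsinP p 1 - arcsinP p x))) := by
  have hx : 0 < x := hx₀.trans_le hxx
  have hp0 : 0 < p := by linarith
  have hxp : x ^ p ≤ 1 := rpow_le_one hx.le hx1 hp0.le
  have hxp0 : 0 ≤ x ^ p := rpow_nonneg hx.le p
  have hwW := rpow_one_div_mul_rpow_sub_one hp (y := 1 - x ^ p) (by linarith)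
  have hw0 : 0 ≤ (1 - x ^ p) ^ (1 / p) := rpow_nonneg (by linarith) _
  have hw1 : (1 - x ^ p) ^ (1 / p) ≤ 1 := rpow_le_one (by linarith) (by linarith) (by positivity)
  obtain ⟨h1, h2⟩ := mul_arcsinP_one_sub_bounds hp ⟨hx.le, hx1⟩
  have hW : (1 - x ^ p) ^ ((p - 1) / p) = ((1 - x ^ p) ^ (1 / p)) ^ (p - 1) := by
    rw [← rpow_mul (by linarith)]
    congr 1
    ring
  rw [hW] at h1 h2
  have hxpp : x ^ (p - 1) * x = x ^ p := by
    rw [rpow_sub_one hx.ne']; field_simp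
  have hW0 : 0 ≤ ((1 - x ^ p) ^ (1 / p)) ^ (p - 1) := rpow_nonneg hw0 _
  set w := (1 - x ^ p) ^ (1 / p)
  set W := w ^ (p - 1)
  set T := (p - 1) * (arcsinP p 1 - arcsinP p x)
  have hT : 0 ≤ T := hW0.trans h2
  have hWx : W * x ≤ W := mul_le_of_le_one_right hW0 hx1
  rw [abs_of_nonneg (by linarith)]
  calc T - W * x ≤ T - x ^ (p - 1) * T * x := by gcongr
    _ = (1 - x ^ (p - 1) * x) * T := by ring
    _ = w * (W * T) := by rw [hxpp, ← hwW]; ring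
    _ ≤ 1 * (W * T) := by gcongr
    _ ≤ x / x₀ * (W * T) := by
      gcongr
      rwa [one_le_div hx₀]
    _ = 1 / x₀ * (W * x * T) := by ring

/-- for `p > 1`, `β > 0`, and the comparison function
`h_α(φ) = 1/(α + β φ)` on `[0, π_p/4)`, `h_α(φ) = 1/(α + β (p-1)(π_p/2 - φ))` on
`[π_p/4, π_p/2]`, there is `C > 0` such that for all `α ∈ (0,1]`,
`|∫₀^{π_p/2} dφ/(α + β cos_p(φ)^(p-1) sin_p(φ)) - ∫₀^{π_p/2} h_α(φ) dφ| ≤ C`. -/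
theorem stmt12 (p β : ℝ) (hp : 1 < p) (hβ : 0 < β) (sinp : ℝ → ℝ)
    (hmaps : ∀ t ∈ Icc (0:ℝ) (piP p / 2), sinp t ∈ Icc (0:ℝ) 1)
    (hleft : ∀ x ∈ Icc (0:ℝ) 1, sinp (arcsinP p x) = x)
    (hright : ∀ t ∈ Icc (0:ℝ) (piP p / 2), arcsinP p (sinp t) = t) :
    ∃ C > (0:ℝ), ∀ α ∈ Ioc (0:ℝ) 1,
      |(∫ φ in (0:ℝ)..(piP p / 2),
          1 / (α + β * ((1 - sinp φ ^ p) ^ (1 / p)) ^ (p - 1) * sinp φ)) -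
        ∫ φ in (0:ℝ)..(piP p / 2),
          (if φ < piP p / 4 then 1 / (α + β * φ)
            else 1 / (α + β * (p - 1) * (piP p / 2 - φ)))| ≤ C := by
  have hpi : 2 ≤ piP p := by
    have h := sub_le_arcsinP_sub hp le_rfl zero_le_one le_rfl
    rw [arcsinP_zero] at h
    unfold piP
    linarith
  have hA1 : arcsinP p 1 = piP p / 2 := by unfold piP; ring
  have hmono : MonotoneOn sinp (Icc 0 (piP p / 2)) := by
    intro s hs t ht hst
    rwa [← (strictMonoOn_arcsinP hp).le_iff_le (hmaps s hs) (hmaps t ht), hright s hs, hright t ht]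
  have hmid : piP p / 4 ∈ Icc 0 (piP p / 2) := ⟨by linarith, by linarith⟩
  obtain ⟨x₀, hx₀⟩ : ∃ x₀, sinp (piP p / 4) = x₀ := ⟨_, rfl⟩
  have hx₀mem := hmaps _ hmid
  have hAx₀ := hright _ hmid
  rw [hx₀] at hx₀mem hAx₀
  have hx₀pos : 0 < x₀ := by
    refine hx₀mem.1.lt_of_ne fun h => ?_
    rw [← h, arcsinP_zero] at hAx₀
    linarith
  have hx₀lt : x₀ < 1 := by
    refine hx₀mem.2.lt_of_ne fun h => ?_
    rw [h, hA1] at hAx₀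
    linarith
  have hx₀p : x₀ ^ p < 1 := rpow_lt_one hx₀pos.le hx₀lt (by linarith)
  have hK₁ : 0 < 1 / (1 - x₀ ^ p) := one_div_pos.2 (by linarith)
  have hK₂ : 0 < 1 / x₀ := one_div_pos.2 hx₀pos
  obtain ⟨K, hK⟩ : ∃ K, 1 / (1 - x₀ ^ p) / β + 1 / x₀ / β = K := ⟨_, rfl⟩
  have hKβ₁ := div_pos hK₁ hβ
  have hKβ₂ := div_pos hK₂ hβ
  have hKpos : 0 < K := by linarith
  have hpi0 : 0 < piP p / 2 := by linarith
  refine ⟨K * (piP p / 2), by positivity, fun α hα => ?_⟩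
  have hα0 : 0 < α := hα.1
  have hg : ∀ φ ∈ Icc 0 (piP p / 2),
      0 ≤ ((1 - sinp φ ^ p) ^ (1 / p)) ^ (p - 1) * sinp φ := fun φ hφ => by
    have hx := hmaps φ hφ
    have := rpow_le_one hx.1 hx.2 (by linarith : 0 ≤ p)
    exact mul_nonneg (rpow_nonneg (rpow_nonneg (by linarith) _) _) hx.1
  have hinv : ∀ y, 0 ≤ y → ‖1 / (α + y)‖ ≤ 1 / α := fun y hy => by
    rw [norm_of_nonneg (by positivity)]
    exact one_div_le_one_div_of_le hα0 (by linarith)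
  have hbdd : ∀ f : ℝ → ℝ, AEMeasurable f (volume.restrict (Icc 0 (piP p / 2))) →
      (∀ φ ∈ Icc 0 (piP p / 2), ‖f φ‖ ≤ 1 / α) →
      IntervalIntegrable f volume 0 (piP p / 2) := fun f hf hfb => by
    rw [intervalIntegrable_iff_integrableOn_Icc_of_le hpi0.le]
    exact IntegrableOn.of_bound (by simp) hf.aestronglyMeasurable (1 / α)
      ((ae_restrict_mem measurableSet_Icc).mono hfb)
  have hint₁ : IntervalIntegrable (fun φ =>
      1 / (α + β * ((1 - sinp φ ^ p) ^ (1 / p)) ^ (p - 1) * sinp φ)) volume 0 (piP p / 2) := by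
    refine hbdd _ ?_ fun φ hφ => ?_
    · have hm := aemeasurable_restrict_of_monotoneOn (μ := volume) measurableSet_Icc hmono
      have hF : Measurable fun x : ℝ =>
        1 / (α + β * ((1 - x ^ p) ^ (1 / p)) ^ (p - 1) * x) := by fun_prop
      exact hF.comp_aemeasurable hm
    · rw [mul_assoc]
      exact hinv _ (mul_nonneg hβ.le (hg φ hφ))
  have hint₂ : IntervalIntegrable (fun φ => if φ < piP p / 4 then 1 / (α + β * φ)
      else 1 / (α + β * (p - 1) * (piP p / 2 - φ))) volume 0 (piP p / 2) := by
    refine hbdd _ (Measurable.ite measurableSet_Iio (by fun_prop) (by fun_prop)).aemeasurable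
      fun φ hφ => ?_
    split_ifs
    · exact hinv _ (mul_nonneg hβ.le hφ.1)
    · exact hinv _ (mul_nonneg (mul_nonneg hβ.le (by linarith)) (by linarith [hφ.2]))
  rw [← intervalIntegral.integral_sub hint₁ hint₂, ← norm_eq_abs]
  have hpt := intervalIntegral.norm_integral_le_of_norm_le_const (a := 0) (b := piP p / 2) (C := K)
    (f := fun φ => 1 / (α + β * ((1 - sinp φ ^ p) ^ (1 / p)) ^ (p - 1) * sinp φ) -
      (if φ < piP p / 4 then 1 / (α + β * φ) else 1 / (α + β * (p - 1) * (piP p / 2 - φ))))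
    fun φ hφ => ?_
  · rwa [sub_zero, abs_of_pos hpi0] at hpt
  rw [uIoc_of_le hpi0.le] at hφ
  have hφ' : φ ∈ Icc 0 (piP p / 2) := Ioc_subset_Icc_self hφ
  have hx := hmaps φ hφ'
  have hAx := hright φ hφ'
  rw [norm_eq_abs, mul_assoc β]
  split_ifs with h
  · have hb := abs_arcsinP_sub_le hp hx.1 (hx₀ ▸ hmono hφ' hmid h.le) hx₀lt
    rw [hAx] at hb
    linarith [abs_one_div_sub_one_div_le hα0 hβ (hg φ hφ') hφ'.1 hK₁.le hb]
  · have hb := abs_mul_arcsinP_one_sub_le hp hx₀pos (hx₀ ▸ hmono hmid hφ' (not_lt.1 h)) hx.2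
    rw [hAx, hA1] at hb
    rw [mul_assoc β]
    linarith [abs_one_div_sub_one_div_le hα0 hβ (hg φ hφ')
      (mul_nonneg (by linarith) (by linarith [hφ.2])) hK₂.le hb]
end

section
/- Let p > 1, a ≥ 0, λ > 0 and D > 0. Suppose w : [0,D] → ℝ is continuously differentiable with w(0) = 0, w(D) = 1, w'(D) = 0, w(t) > 0 for all t ∈ (0,D], the function t ↦ |w'(t)|^{p−2}·w'(t) is differentiable on (0,D], and d/dt(|w'(t)|^{p−2}·w'(t)) + a·|w'(t)|^{p−2}·w'(t) + λ·|w(t)|^{p−2}·w(t) = 0 for all t ∈ (0,D]. Then w'(t) ≥ 0 for all t ∈ [0,D] and w is strictly increasing on [0,D]. -/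
open Real MeasureTheory Set

/-- let `p > 1`, `a ≥ 0`, `λ > 0`, `D > 0`, and let `w : [0,D] → ℝ` be a
continuously differentiable solution of
`(|w'|^(p-2) w')' + a |w'|^(p-2) w' + λ |w|^(p-2) w = 0` on `(0,D]` with `w(0) = 0`,
`w(D) = 1`, `w'(D) = 0` and `w > 0` on `(0,D]`.  Then `w' ≥ 0` on `[0,D]` and `w` is
strictly increasing on `[0,D]`. -/
theorem stmt13 (p a lam D : ℝ) (hp : 1 < p) (ha : 0 ≤ a) (hlam : 0 < lam) (hD : 0 < D)
    (w w' g : ℝ → ℝ)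
    (hw'cont : ContinuousOn w' (Icc 0 D))
    (hw : ∀ t ∈ Icc (0:ℝ) D, HasDerivWithinAt w (w' t) (Icc 0 D) t)
    (hw0 : w 0 = 0) (hwD : w D = 1) (hw'D : w' D = 0)
    (hwpos : ∀ t ∈ Ioc (0:ℝ) D, 0 < w t)
    (hode : ∀ t ∈ Ioc (0:ℝ) D,
      HasDerivWithinAt (fun s => |w' s| ^ (p - 2) * w' s) (g t) (Ioc 0 D) t ∧
      g t + a * (|w' t| ^ (p - 2) * w' t) + lam * (|w t| ^ (p - 2) * w t) = 0) :
    (∀ t ∈ Icc (0:ℝ) D, 0 ≤ w' t) ∧ StrictMonoOn w (Icc 0 D) := by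
  have hanti : StrictAntiOn (fun s => exp (a * s) * (|w' s| ^ (p - 2) * w' s)) (Ioc 0 D) := by
    have hder : ∀ t ∈ Ioc (0 : ℝ) D,
        HasDerivWithinAt (fun s => exp (a * s) * (|w' s| ^ (p - 2) * w' s))
          (-(lam * exp (a * t) * (|w t| ^ (p - 2) * w t))) (Ioc 0 D) t := by
      intro t ht
      obtain ⟨hg, heq⟩ := hode t ht
      have hexp : HasDerivWithinAt (fun s => exp (a * s)) (exp (a * t) * (a * 1)) (Ioc 0 D) t :=
        (((hasDerivAt_id t).const_mul a).exp).hasDerivWithinAt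
      refine (hexp.mul hg).congr_deriv ?_
      linear_combination exp (a * t) * heq
    refine strictAntiOn_of_deriv_neg (convex_Ioc 0 D)
      (fun t ht => (hder t ht).continuousWithinAt) fun t ht => ?_
    rw [interior_Ioc] at ht
    rw [((hder t (Ioo_subset_Ioc_self ht)).hasDerivAt (Ioc_mem_nhds ht.1 ht.2)).deriv]
    have hwt := hwpos t (Ioo_subset_Ioc_self ht)
    have : 0 < |w t| ^ (p - 2) := rpow_pos_of_pos (abs_pos.2 hwt.ne') _
    exact neg_neg_of_pos (by positivity)
  have hpos : ∀ t ∈ Ioo (0 : ℝ) D, 0 < w' t := by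
    intro t ht
    have h := hanti (Ioo_subset_Ioc_self ht) (right_mem_Ioc.2 hD) ht.2
    simp only [hw'D, mul_zero] at h
    exact pos_of_mul_pos_right (pos_of_mul_pos_right h (exp_pos _).le)
      (rpow_nonneg (abs_nonneg _) _)
  have hclosure : closure (Ioo 0 D) = Icc 0 D := closure_Ioo hD.ne
  constructor
  · intro t ht
    rw [← hclosure] at ht hw'cont
    exact le_on_closure (fun s hs => (hpos s hs).le) continuousOn_const hw'cont ht
  · refine strictMonoOn_of_deriv_pos (convex_Icc 0 D)
      (fun t ht => (hw t ht).continuousWithinAt) fun t ht => ?_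
    rw [interior_Icc] at ht
    rw [((hw t (Ioo_subset_Icc_self ht)).hasDerivAt (Icc_mem_nhds ht.1 ht.2)).deriv]
    exact hpos t ht
end

section
/- Let p > 1, a ≥ 0, λ > 0 and D > 0. Suppose w : [0,D] → ℝ is continuously differentiable with w(t) > 0 and w'(t) ≥ 0 for all t ∈ (0,D], the function t ↦ |w'(t)|^{p−2}·w'(t) is differentiable on (0,D), and d/dt(|w'(t)|^{p−2}·w'(t)) + a·|w'(t)|^{p−2}·w'(t) + λ·|w(t)|^{p−2}·w(t) = 0 on (0,D). Define f : (0,D] → ℝ by f(t) = −ln w(t). Then t ↦ |f'(t)|^{p−2}·f'(t) is differentiable on (0,D) and d/dt(|f'(t)|^{p−2}·f'(t)) = −a·|f'(t)|^{p−2}·f'(t) + λ + (p−1)·|f'(t)|^p for all t ∈ (0,D). -/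
open Real MeasureTheory Set

/-- The map `x ↦ |x|^(p-2) x` is multiplicative under division by a positive number, up to sign. -/
theorem abs_rpow_sub_two_mul_neg_div {x y : ℝ} (p : ℝ) (hy : 0 < y) :
    |-(x / y)| ^ (p - 2) * -(x / y) = -((|x| ^ (p - 2) * x) * y ^ (1 - p)) := by
  have hpow : y ^ (1 - p) = (y ^ (p - 2))⁻¹ * y⁻¹ := by
    rw [← rpow_neg hy.le, ← rpow_neg_one, ← rpow_add hy]
    congr 1
    ring
  rw [abs_neg, abs_div, abs_of_pos hy, div_rpow (abs_nonneg x) hy.le, hpow]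
  ring

theorem abs_rpow_sub_two_mul_mul_self {p : ℝ} (hp : p ≠ 0) (x : ℝ) :
    |x| ^ (p - 2) * x * x = |x| ^ p := by
  rcases eq_or_ne x 0 with rfl | hx
  · simp [zero_rpow hp]
  · rw [mul_assoc, ← abs_mul_abs_self x, ← pow_two, ← rpow_natCast |x| 2,
      ← rpow_add (abs_pos.mpr hx)]
    norm_num

/-- let `p > 1`, `a ≥ 0`, `λ > 0`, `D > 0`, and let `w : [0,D] → ℝ` be a
continuously differentiable positive nondecreasing solution of
`(|w'|^(p-2) w')' + a |w'|^(p-2) w' + λ |w|^(p-2) w = 0` on `(0,D)`.  Then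
`f = -ln w` satisfies: `t ↦ |f'|^(p-2) f'` is differentiable on `(0,D)` with
`(|f'|^(p-2) f')' = -a |f'|^(p-2) f' + λ + (p-1) |f'|^p` on `(0,D)`. -/
theorem stmt14 (p a lam D : ℝ) (hp : 1 < p) (ha : 0 ≤ a) (hlam : 0 < lam) (hD : 0 < D)
    (w w' g : ℝ → ℝ)
    (hw'cont : ContinuousOn w' (Icc 0 D))
    (hw : ∀ t ∈ Icc (0:ℝ) D, HasDerivWithinAt w (w' t) (Icc 0 D) t)
    (hwpos : ∀ t ∈ Ioc (0:ℝ) D, 0 < w t ∧ 0 ≤ w' t)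
    (hode : ∀ t ∈ Ioo (0:ℝ) D,
      HasDerivAt (fun s => |w' s| ^ (p - 2) * w' s) (g t) t ∧
      g t + a * (|w' t| ^ (p - 2) * w' t) + lam * (|w t| ^ (p - 2) * w t) = 0) :
    ∃ f' : ℝ → ℝ,
      (∀ t ∈ Ioo (0:ℝ) D, HasDerivAt (fun s => -Real.log (w s)) (f' t) t) ∧
      ∀ t ∈ Ioo (0:ℝ) D,
        HasDerivAt (fun s => |f' s| ^ (p - 2) * f' s)
          (-a * (|f' t| ^ (p - 2) * f' t) + lam + (p - 1) * |f' t| ^ p) t := by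
  have hpos : ∀ t ∈ Ioo (0:ℝ) D, 0 < w t := fun t ht => (hwpos t (Ioo_subset_Ioc_self ht)).1
  have hderiv : ∀ t ∈ Ioo (0:ℝ) D, HasDerivAt w (w' t) t := fun t ht =>
    (hw t (Ioo_subset_Icc_self ht)).hasDerivAt (Icc_mem_nhds ht.1 ht.2)
  refine ⟨fun s => -(w' s / w s), fun t ht => ((hderiv t ht).log (hpos t ht).ne').neg,
    fun t ht => ?_⟩
  obtain ⟨hG, heq⟩ := hode t ht
  have hwt := hpos t ht
  have hF := (hG.mul ((hderiv t ht).rpow_const (p := 1 - p) (Or.inl hwt.ne'))).neg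
  have hlocal : (fun s => |-(w' s / w s)| ^ (p - 2) * -(w' s / w s)) =ᶠ[nhds t]
      fun s => -((|w' s| ^ (p - 2) * w' s) * w s ^ (1 - p)) := by
    filter_upwards [Ioo_mem_nhds ht.1 ht.2] with s hs
    exact abs_rpow_sub_two_mul_neg_div p (hpos s hs)
  refine (hF.congr_of_eventuallyEq hlocal).congr_deriv ?_
  have hcancel : |w t| ^ (p - 2) * w t * w t ^ (1 - p) = 1 := by
    rw [abs_of_pos hwt]
    nth_rewrite 2 [← rpow_one (w t)]
    rw [← rpow_add hwt, ← rpow_add hwt]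
    ring_nf
    exact rpow_zero _
  have hpow : |-(w' t / w t)| ^ p = |w' t| ^ (p - 2) * w' t * w' t * w t ^ (1 - p - 1) := by
    rw [abs_rpow_sub_two_mul_mul_self (by linarith), abs_neg, abs_div, abs_of_pos hwt,
      div_rpow (abs_nonneg _) hwt.le, div_eq_mul_inv, ← rpow_neg hwt.le]
    ring_nf
  rw [abs_rpow_sub_two_mul_neg_div p hwt, hpow]
  linear_combination (-w t ^ (1 - p)) * heq + lam * hcancel
end

section
/- Let p > 1, a ≥ 0, λ > 0 and D > 0. Suppose w : [0,D] → ℝ is continuously differentiable with w(0) = 0, w'(D) = 0, w(t) > 0 and w'(t) ≥ 0 for all t ∈ (0,D], the function t ↦ e^{a·t}·|w'(t)|^{p−2}·w'(t) is differentiable on (0,D) with d/dt(e^{a·t}·|w'(t)|^{p−2}·w'(t)) = −λ·e^{a·t}·|w(t)|^{p−2}·w(t) on (0,D). Then for every continuously differentiable function u : [0,D] → ℝ with u(0) = 0, one has ∫₀^D |u'(t)|^p·e^{a·t} dt ≥ λ·∫₀^D |u(t)|^p·e^{a·t} dt. -/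
open Real MeasureTheory Set

open Topology

/-- Young's inequality in the form used for the one-dimensional Picone inequality. -/
theorem mul_mul_rpow_sub_one_le {p x y : ℝ} (hp : 1 < p) (hx : 0 ≤ x) (hy : 0 ≤ y) :
    p * x * y ^ (p - 1) - (p - 1) * y ^ p ≤ x ^ p := by
  have hp1 : p - 1 ≠ 0 := by linarith
  have hp0 : 0 < p := by linarith
  have h := Real.young_inequality_of_nonneg hx (rpow_nonneg hy (p - 1))
    (Real.HolderConjugate.conjExponent hp)
  have hpow : (y ^ (p - 1)) ^ p.conjExponent = y ^ p := by
    rw [← rpow_mul hy, Real.conjExponent]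
    congr 1
    field_simp
  rw [hpow, Real.conjExponent] at h
  have h2 : p * (x ^ p / p + y ^ p / (p / (p - 1))) = x ^ p + (p - 1) * y ^ p := by
    field_simp
  nlinarith [mul_le_mul_of_nonneg_left h hp0.le]

theorem abs_rpow_sub_two_mul_self {p x : ℝ} (hp : 1 < p) (hx : 0 ≤ x) :
    |x| ^ (p - 2) * x = x ^ (p - 1) := by
  rw [abs_of_nonneg hx]
  rcases hx.eq_or_lt with rfl | hx
  · rw [mul_zero, zero_rpow (by linarith)]
  · rw [← rpow_add_one hx.ne']
    congr 1
    ring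

/-- Pointwise Picone inequality, with `v`, `v'` (resp. `x`, `x'`) the values of the
positive function and of the test function and of their derivatives. -/
theorem picone_pointwise {p v v' x x' : ℝ} (hp : 1 < p) (hv : 0 < v) (hv' : 0 ≤ v') :
    v' ^ (p - 1) * (p * |x| ^ (p - 2) * x * x' * v ^ (1 - p)
      + |x| ^ p * (v' * (1 - p) * v ^ (1 - p - 1))) ≤ |x'| ^ p := by
  have hy : 0 ≤ v' * |x| / v := by positivity
  refine le_trans ?_ (mul_mul_rpow_sub_one_le hp (abs_nonneg x') hy)
  have h1 : (v' * |x| / v) ^ (p - 1) = v' ^ (p - 1) * |x| ^ (p - 1) * v ^ (1 - p) := by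
    rw [div_rpow (by positivity) hv.le, mul_rpow hv' (abs_nonneg x), div_eq_mul_inv,
      ← rpow_neg hv.le, neg_sub]
  have h2 : (v' * |x| / v) ^ p = v' ^ (p - 1) * v' * |x| ^ p * v ^ (1 - p - 1) := by
    rw [div_rpow (by positivity) hv.le, mul_rpow hv' (abs_nonneg x), div_eq_mul_inv,
      ← rpow_neg hv.le, ← rpow_add_one' hv' (by linarith), sub_add_cancel]
    congr 2
    ring
  have h3 : |x| ^ (p - 2) * x * x' ≤ |x'| * |x| ^ (p - 1) := by
    have h := abs_rpow_sub_two_mul_self hp (abs_nonneg x)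
    rw [abs_abs] at h
    calc |x| ^ (p - 2) * x * x' = |x| ^ (p - 2) * (x * x') := by ring
      _ ≤ |x| ^ (p - 2) * (|x| * |x'|) := by
        refine mul_le_mul_of_nonneg_left ?_ (by positivity)
        rw [← abs_mul]
        exact le_abs_self _
      _ = |x'| * |x| ^ (p - 1) := by rw [← h]; ring
  rw [h1, h2]
  have hc : 0 ≤ p * v' ^ (p - 1) * v ^ (1 - p) := by positivity
  nlinarith [mul_le_mul_of_nonneg_left h3 hc]

/-- let `p > 1`, `a ≥ 0`, `λ > 0`, `D > 0`, and let `w : [0,D] → ℝ` be a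
continuously differentiable function with `w(0) = 0`, `w'(D) = 0`, `w > 0` and `w' ≥ 0` on
`(0,D]`, such that `t ↦ e^{at} |w'|^(p-2) w'` is differentiable on `(0,D)` with derivative
`-λ e^{at} |w|^(p-2) w`.  Then for every continuously differentiable `u : [0,D] → ℝ` with
`u(0) = 0` one has `∫₀^D |u'|^p e^{at} dt ≥ λ ∫₀^D |u|^p e^{at} dt`. -/
theorem stmt15 (p a lam D : ℝ) (hp : 1 < p) (ha : 0 ≤ a) (hlam : 0 < lam) (hD : 0 < D)
    (w w' : ℝ → ℝ)
    (hw'cont : ContinuousOn w' (Icc 0 D))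
    (hw : ∀ t ∈ Icc (0:ℝ) D, HasDerivWithinAt w (w' t) (Icc 0 D) t)
    (hw0 : w 0 = 0) (hw'D : w' D = 0)
    (hwpos : ∀ t ∈ Ioc (0:ℝ) D, 0 < w t ∧ 0 ≤ w' t)
    (hE : ∀ t ∈ Ioo (0:ℝ) D,
      HasDerivAt (fun s => Real.exp (a * s) * (|w' s| ^ (p - 2) * w' s))
        (-lam * Real.exp (a * t) * (|w t| ^ (p - 2) * w t)) t) :
    ∀ u u' : ℝ → ℝ,
      ContinuousOn u' (Icc 0 D) →
      (∀ t ∈ Icc (0:ℝ) D, HasDerivWithinAt u (u' t) (Icc 0 D) t) →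
      u 0 = 0 →
      (∫ t in (0:ℝ)..D, |u' t| ^ p * Real.exp (a * t)) ≥
        lam * ∫ t in (0:ℝ)..D, |u t| ^ p * Real.exp (a * t) := by
  intro u u' hu'cont hu hu0
  have hp0 : 0 < p := by linarith
  have hp1 : 0 < p - 1 := by linarith
  have hwc : ContinuousOn w (Icc 0 D) := fun t ht => (hw t ht).continuousWithinAt
  have huc : ContinuousOn u (Icc 0 D) := fun t ht => (hu t ht).continuousWithinAt
  have h0mem : (0 : ℝ) ∈ Icc 0 D := left_mem_Icc.2 hD.le
  have hDmem : D ∈ Icc 0 D := right_mem_Icc.2 hD.le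
  have hcl : closure (Ioc 0 D) = Icc 0 D := closure_Ioc hD.ne
  have hw'nn : ∀ t ∈ Icc 0 D, 0 ≤ w' t := by
    intro t ht
    rw [← hcl] at ht
    exact closure_minimal (s := Ioc 0 D) (t := Icc 0 D ∩ w' ⁻¹' Ici 0)
      (fun s hs => ⟨Ioc_subset_Icc_self hs, (hwpos s hs).2⟩)
      (hw'cont.preimage_isClosed_of_isClosed isClosed_Icc isClosed_Ici) ht |>.2
  set φ : ℝ → ℝ := fun s => Real.exp (a * s) * (|w' s| ^ (p - 2) * w' s) with hφ
  have hφeq : ∀ t ∈ Icc 0 D, φ t = Real.exp (a * t) * w' t ^ (p - 1) := fun t ht => by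
    rw [hφ]
    simp only [abs_rpow_sub_two_mul_self hp (hw'nn t ht)]
  have hexp : ContinuousOn (fun t => Real.exp (a * t)) (Icc 0 D) := by fun_prop
  have hφc : ContinuousOn φ (Icc 0 D) :=
    (hexp.mul (hw'cont.rpow_const fun _ _ => Or.inr hp1.le)).congr hφeq
  have hw'0 : 0 < w' 0 := by
    have hanti : StrictAntiOn φ (Icc 0 D) := by
      refine strictAntiOn_of_deriv_neg (convex_Icc 0 D) hφc fun t ht => ?_
      rw [interior_Icc] at ht
      rw [(hE t ht).deriv]
      have hwt := (hwpos t (Ioo_subset_Ioc_self ht)).1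
      have : 0 < lam * Real.exp (a * t) * (|w t| ^ (p - 2) * w t) := by positivity
      linarith
    have h := hanti h0mem hDmem hD
    rw [hφeq D hDmem, hφeq 0 h0mem, hw'D, zero_rpow hp1.ne', mul_zero] at h
    refine (hw'nn 0 h0mem).lt_of_ne fun h0 => ?_
    rw [← h0, zero_rpow hp1.ne', mul_zero] at h
    exact lt_irrefl _ h
  set F : ℝ → ℝ := fun t => φ t * (|u t| ^ p * w t ^ (1 - p)) with hF
  have hF0 : F 0 = 0 := by simp [hF, hu0, zero_rpow hp0.ne']
  have hFD : F D = 0 := by simp [hF, hφ, hw'D]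
  have hFc : ContinuousOn F (Icc 0 D) := by
    intro t ht
    rcases ht.1.eq_or_lt with rfl | ht0
    · have hnhds : 𝓝[Icc 0 D \ {0}] (0 : ℝ) = 𝓝[Ioc 0 D] 0 := by rw [Icc_sdiff_left]
      have hsu := hasDerivWithinAt_iff_tendsto_slope.1 (hu 0 h0mem)
      have hsw := hasDerivWithinAt_iff_tendsto_slope.1 (hw 0 h0mem)
      have hratio := (hsu.abs.div hsw hw'0.ne').rpow_const (p := p - 1) (Or.inr hp1.le)
      rw [hnhds] at hratio
      have hsub : Ioc 0 D ⊆ Icc 0 D := Ioc_subset_Icc_self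
      have hprod := (((hφc 0 h0mem).mono hsub).tendsto.mul
        ((huc 0 h0mem).mono hsub).tendsto.abs).mul hratio
      rw [hu0, abs_zero, mul_zero, zero_mul] at hprod
      rw [← continuousWithinAt_sdiff_self, Icc_sdiff_left, ContinuousWithinAt, hF0]
      refine hprod.congr' ?_
      filter_upwards [self_mem_nhdsWithin] with t ht
      have hwt := (hwpos t ht).1
      have ht0 := ht.1
      have hq : |slope u 0 t| / slope w 0 t = |u t| / w t := by
        simp only [slope_def_field, hu0, hw0, sub_zero, abs_div, abs_of_pos ht0]
        field_simp
      simp only [Pi.div_apply, hF, hq]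
      rw [div_rpow (abs_nonneg _) hwt.le, div_eq_mul_inv, ← rpow_neg hwt.le, neg_sub, mul_assoc,
        ← mul_assoc |u t|, mul_comm |u t|, ← rpow_add_one' (abs_nonneg _) (by linarith),
        sub_add_cancel]
    · have hwt := (hwpos t ⟨ht0, ht.2⟩).1
      exact (hφc t ht).mul (((huc t ht).abs.rpow_const (Or.inr hp0.le)).mul
        ((hwc t ht).rpow_const (Or.inl hwt.ne')))
  have hIu' : ContinuousOn (fun t => |u' t| ^ p * Real.exp (a * t)) (Icc 0 D) :=
    (hu'cont.abs.rpow_const fun _ _ => Or.inr hp0.le).mul hexp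
  have hIu : ContinuousOn (fun t => |u t| ^ p * Real.exp (a * t)) (Icc 0 D) :=
    (huc.abs.rpow_const fun _ _ => Or.inr hp0.le).mul hexp
  have hIlam : ContinuousOn (fun t => lam * (|u t| ^ p * Real.exp (a * t))) (Icc 0 D) :=
    continuousOn_const.mul hIu
  have hFderiv : ∀ t ∈ Ioo 0 D, HasDerivAt F
      ((-lam * Real.exp (a * t) * (|w t| ^ (p - 2) * w t)) * (|u t| ^ p * w t ^ (1 - p))
        + φ t * (p * |u t| ^ (p - 2) * u t * u' t * w t ^ (1 - p)
          + |u t| ^ p * (w' t * (1 - p) * w t ^ (1 - p - 1)))) t := by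
    intro t ht
    have hwt := (hwpos t (Ioo_subset_Ioc_self ht)).1
    have htI := Ioo_subset_Icc_self ht
    have hnt : Icc 0 D ∈ 𝓝 t := Icc_mem_nhds ht.1 ht.2
    exact (hE t ht).mul (((hasDerivAt_abs_rpow (u t) hp).comp t
      ((hu t htI).hasDerivAt hnt)).mul
        (((hw t htI).hasDerivAt hnt).rpow_const (Or.inl hwt.ne')))
  have hmain : F D - F 0 ≤ ∫ t in (0:ℝ)..D,
      (|u' t| ^ p * Real.exp (a * t) - lam * (|u t| ^ p * Real.exp (a * t))) := by
    refine intervalIntegral.sub_le_integral_of_hasDeriv_right_of_le hD.le hFc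
      (fun t ht => (hFderiv t ht).hasDerivWithinAt)
      (hIu'.sub hIlam).integrableOn_Icc fun t ht => ?_
    have hwt := (hwpos t (Ioo_subset_Ioc_self ht)).1
    have htI := Ioo_subset_Icc_self ht
    have hpic := picone_pointwise (x := u t) (x' := u' t) hp hwt (hw'nn t htI)
    have hww : w t ^ (p - 1) * w t ^ (1 - p) = 1 := by
      rw [← rpow_add hwt, sub_add_sub_cancel, sub_self, rpow_zero]
    rw [hφeq t htI, abs_rpow_sub_two_mul_self hp hwt.le]
    calc _ = Real.exp (a * t) * (w' t ^ (p - 1) *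
            (p * |u t| ^ (p - 2) * u t * u' t * w t ^ (1 - p)
              + |u t| ^ p * (w' t * (1 - p) * w t ^ (1 - p - 1))))
          - lam * Real.exp (a * t) * |u t| ^ p * (w t ^ (p - 1) * w t ^ (1 - p)) := by ring
      _ ≤ Real.exp (a * t) * |u' t| ^ p - lam * Real.exp (a * t) * |u t| ^ p * 1 := by
        rw [hww]
        gcongr
      _ = _ := by ring
  rw [intervalIntegral.integral_sub (hIu'.intervalIntegrable_of_Icc hD.le)
    (hIlam.intervalIntegrable_of_Icc hD.le), intervalIntegral.integral_const_mul, hF0, hFD] at hmain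
  linarith
end

section
/- Let n ≥ 2 be an integer and ε > 0. Let ψ : ℝ → ℝ be a smooth nondecreasing function with 0 ≤ ψ ≤ 1, ψ(x) = 0 for x ≤ ε/2 and ψ(x) = 1 for x ≥ ε. Define h(x) = (1 − ψ(x))·coth x − ψ(x) for x > 0, and define f : [0,∞) → ℝ by f(x) = sinh x for 0 ≤ x ≤ ε/2 and f(x) = sinh(ε/2)·exp(∫_{ε/2}^x h(t) dt) for x ≥ ε/2. Then f is smooth and positive on (0,∞), and for every x > 0, (n−2)·(1 − f'(x)²)/f(x)² − f''(x)/f(x) ≥ −(n−1). -/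
open Real MeasureTheory Set

/-- Logarithmic derivative of the warping function: `coth` cut off to `-1` by `ψ`. -/
noncomputable def cutoffCoth (ψ : ℝ → ℝ) (t : ℝ) : ℝ :=
  (1 - ψ t) * (Real.cosh t / Real.sinh t) - ψ t

theorem uIcc_subset_Ioi_zero {a b : ℝ} (ha : 0 < a) (hb : 0 < b) : uIcc a b ⊆ Ioi 0 :=
  fun _ hx => (lt_min ha hb).trans_le hx.1

theorem contDiffOn_coth :
    ContDiffOn ℝ (⊤ : ℕ∞) (fun t => Real.cosh t / Real.sinh t) (Ioi 0) :=
  Real.contDiff_cosh.contDiffOn.div Real.contDiff_sinh.contDiffOn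
    fun _ hx => (Real.sinh_pos_iff.2 hx).ne'

theorem hasDerivAt_coth {x : ℝ} (hx : 0 < x) :
    HasDerivAt (fun t => Real.cosh t / Real.sinh t) (1 - (Real.cosh x / Real.sinh x) ^ 2) x := by
  have hs : Real.sinh x ≠ 0 := (Real.sinh_pos_iff.2 hx).ne'
  refine ((Real.hasDerivAt_cosh x).div (Real.hasDerivAt_sinh x) hs).congr_deriv ?_
  field_simp

theorem one_le_coth {x : ℝ} (hx : 0 < x) : 1 ≤ Real.cosh x / Real.sinh x :=
  (one_le_div (Real.sinh_pos_iff.2 hx)).2 (Real.sinh_lt_cosh x).le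

theorem integral_coth {a b : ℝ} (ha : 0 < a) (hb : 0 < b) :
    ∫ t in a..b, Real.cosh t / Real.sinh t = Real.log (Real.sinh b) - Real.log (Real.sinh a) := by
  have hsub := uIcc_subset_Ioi_zero ha hb
  refine intervalIntegral.integral_eq_sub_of_hasDerivAt (f := fun t => Real.log (Real.sinh t))
    (fun x hx => ?_) (contDiffOn_coth.continuousOn.mono hsub).intervalIntegrable
  exact (Real.hasDerivAt_sinh x).log (Real.sinh_pos_iff.2 (hsub hx)).ne'

theorem sinh_mul_exp_integral_coth {a b : ℝ} (ha : 0 < a) (hb : 0 < b) :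
    Real.sinh a * Real.exp (∫ t in a..b, Real.cosh t / Real.sinh t) = Real.sinh b := by
  have hsa := Real.sinh_pos_iff.2 ha
  rw [integral_coth ha hb, Real.exp_sub, Real.exp_log (Real.sinh_pos_iff.2 hb), Real.exp_log hsa]
  field_simp

theorem contDiffOn_cutoffCoth {ψ : ℝ → ℝ} (hψ : ContDiff ℝ (⊤ : ℕ∞) ψ) :
    ContDiffOn ℝ (⊤ : ℕ∞) (cutoffCoth ψ) (Ioi 0) :=
  ((contDiff_const.sub hψ).contDiffOn.mul contDiffOn_coth).sub hψ.contDiffOn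

theorem hasDerivAt_cutoffCoth {ψ : ℝ → ℝ} (hψ : Differentiable ℝ ψ) {x : ℝ} (hx : 0 < x) :
    HasDerivAt (cutoffCoth ψ) ((1 - ψ x) * (1 - (Real.cosh x / Real.sinh x) ^ 2) -
      deriv ψ x * (Real.cosh x / Real.sinh x + 1)) x := by
  have hd := (hψ x).hasDerivAt
  refine (((hd.const_sub 1).mul (hasDerivAt_coth hx)).sub hd).congr_deriv ?_
  ring

theorem cutoffCoth_le_coth {ψ : ℝ → ℝ} {x : ℝ} (h0 : 0 ≤ ψ x) (hx : 0 < x) :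
    cutoffCoth ψ x ≤ Real.cosh x / Real.sinh x := by
  have := one_le_coth hx
  unfold cutoffCoth
  nlinarith

theorem hasDerivAt_integral_of_continuousOn_Ioi {h : ℝ → ℝ} (hc : ContinuousOn h (Ioi 0))
    {a x : ℝ} (ha : 0 < a) (hx : 0 < x) :
    HasDerivAt (fun y => ∫ t in a..y, h t) (h x) x :=
  intervalIntegral.integral_hasDerivAt_right
    (hc.mono (uIcc_subset_Ioi_zero ha hx)).intervalIntegrable
    (hc.stronglyMeasurableAtFilter isOpen_Ioi x hx) (hc.continuousAt (Ioi_mem_nhds hx))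

theorem contDiffOn_integral_of_contDiffOn_Ioi {h : ℝ → ℝ}
    (hh : ContDiffOn ℝ (⊤ : ℕ∞) h (Ioi 0)) {a : ℝ} (ha : 0 < a) :
    ContDiffOn ℝ (⊤ : ℕ∞) (fun y => ∫ t in a..y, h t) (Ioi 0) := by
  have hd : ∀ x ∈ Ioi (0 : ℝ), HasDerivAt (fun y => ∫ t in a..y, h t) (h x) x :=
    fun x hx => hasDerivAt_integral_of_continuousOn_Ioi hh.continuousOn ha hx
  exact (contDiffOn_infty_iff_deriv_of_isOpen isOpen_Ioi).2
    ⟨fun x hx => (hd x hx).differentiableAt.differentiableWithinAt,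
      hh.congr fun x hx => (hd x hx).deriv⟩

/-- With `m = n - 2`, `c = coth x`, `p = ψ x`, `q = ψ' x` and `w = f x`, the radial Ricci bound. -/
theorem radial_ricci_bound {m c p q s w : ℝ} (hm : 0 ≤ m) (hc : 1 ≤ c) (hp0 : 0 ≤ p)
    (hp1 : p ≤ 1) (hq : 0 ≤ q) (hw : 0 < w) (hws : w ≤ s) (hs : 1 / s ^ 2 = c ^ 2 - 1) :
    -(m + 1) ≤ m * (1 / w ^ 2 - ((1 - p) * c - p) ^ 2) -
      ((1 - p) * (1 - c ^ 2) - q * (c + 1) + ((1 - p) * c - p) ^ 2) := by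
  have hinv : c ^ 2 - 1 ≤ 1 / w ^ 2 :=
    hs ▸ one_div_le_one_div_of_le (by positivity) (by gcongr)
  have hsum : c - 1 ≤ (2 - p) * c - p := by nlinarith
  have h1 : 0 ≤ m * (1 / w ^ 2 - (c ^ 2 - 1)) := mul_nonneg hm (by linarith)
  have h2 : 0 ≤ q * (c + 1) := by positivity
  have h3 : 0 ≤ p * (c + 1) * ((2 - p) * c - p - (c - 1)) :=
    mul_nonneg (by positivity) (by linarith)
  have h4 : 0 ≤ m * (p * (c + 1) * ((2 - p) * c - p)) :=
    mul_nonneg hm (mul_nonneg (by positivity) (by linarith))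
  linear_combination h1 + h2 + h3 + h4

/-- let `n ≥ 2`, `ε > 0`, and `ψ : ℝ → ℝ` a smooth nondecreasing cutoff with
`0 ≤ ψ ≤ 1`, `ψ = 0` on `(-∞, ε/2]`, `ψ = 1` on `[ε, ∞)`.  With
`h(x) = (1 - ψ(x)) coth x - ψ(x)` and `f(x) = sinh x` for `x ≤ ε/2`,
`f(x) = sinh(ε/2) exp(∫_{ε/2}^x h)` for `x ≥ ε/2`, the function `f` is smooth and
positive on `(0,∞)` and satisfies `(n-2)(1 - f'²)/f² - f''/f ≥ -(n-1)` on `(0,∞)`. -/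
theorem stmt17 (n : ℕ) (hn : 2 ≤ n) (ε : ℝ) (hε : 0 < ε) (ψ f : ℝ → ℝ)
    (hψsmooth : ContDiff ℝ (⊤ : ℕ∞) ψ) (hψmono : Monotone ψ)
    (hψ01 : ∀ x, ψ x ∈ Icc (0:ℝ) 1)
    (hψ0 : ∀ x ≤ ε / 2, ψ x = 0) (hψ1 : ∀ x, ε ≤ x → ψ x = 1)
    (hf : ∀ x, f x = if x ≤ ε / 2 then Real.sinh x
      else Real.sinh (ε / 2) *
        Real.exp (∫ t in (ε / 2)..x, ((1 - ψ t) * (Real.cosh t / Real.sinh t) - ψ t))) :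
    ContDiffOn ℝ (⊤ : ℕ∞) f (Ioi 0) ∧
    (∀ x : ℝ, 0 < x → 0 < f x) ∧
    ∀ x : ℝ, 0 < x →
      (n - 2 : ℝ) * (1 - deriv f x ^ 2) / f x ^ 2 - deriv (deriv f) x / f x ≥
        -(n - 1 : ℝ) := by
  have ha : 0 < ε / 2 := half_pos hε
  have hsa := Real.sinh_pos_iff.2 ha
  have hh := contDiffOn_cutoffCoth hψsmooth
  have hψdiff : Differentiable ℝ ψ := hψsmooth.differentiable (by simp)
  have hfeq : ∀ x ∈ Ioi (0 : ℝ),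
      f x = Real.sinh (ε / 2) * Real.exp (∫ t in (ε / 2)..x, cutoffCoth ψ t) := by
    intro x hx
    rw [hf]
    split_ifs with hle
    · rw [← sinh_mul_exp_integral_coth ha hx]
      congr 2
      refine intervalIntegral.integral_congr fun t ht => ?_
      rw [uIcc_of_ge hle] at ht
      simp [cutoffCoth, hψ0 t ht.2]
    · rfl
  have hpos : ∀ x : ℝ, 0 < x → 0 < f x := fun x hx => by
    rw [hfeq x hx]
    positivity
  have hle : ∀ x : ℝ, 0 < x → f x ≤ Real.sinh x := by
    intro x hx
    rcases le_total x (ε / 2) with hxa | hxa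
    · rw [hf, if_pos hxa]
    · rw [hfeq x hx, ← sinh_mul_exp_integral_coth ha hx]
      have hsub := uIcc_subset_Ioi_zero ha hx
      gcongr
      exact intervalIntegral.integral_mono_on hxa
        (hh.continuousOn.mono hsub).intervalIntegrable
        (contDiffOn_coth.continuousOn.mono hsub).intervalIntegrable
        fun t ht => cutoffCoth_le_coth (hψ01 t).1 (ha.trans_le ht.1)
  have hderiv : ∀ x : ℝ, 0 < x → HasDerivAt f (f x * cutoffCoth ψ x) x := by
    intro x hx
    have hF := ((hasDerivAt_integral_of_continuousOn_Ioi hh.continuousOn ha hx).exp).const_mul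
      (Real.sinh (ε / 2))
    rw [← mul_assoc, ← hfeq x hx] at hF
    exact hF.congr_of_eventuallyEq (Filter.eventuallyEq_of_mem (Ioi_mem_nhds hx) hfeq)
  refine ⟨?_, hpos, fun x hx => ?_⟩
  · exact (contDiffOn_const.mul (contDiffOn_integral_of_contDiffOn_Ioi hh ha).exp).congr hfeq
  · have hdd : HasDerivAt (deriv f) _ x :=
      ((hderiv x hx).mul (hasDerivAt_cutoffCoth hψdiff hx)).congr_of_eventuallyEq
        (Filter.eventuallyEq_of_mem (Ioi_mem_nhds hx) fun y hy => (hderiv y hy).deriv)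
    have hs : 1 / Real.sinh x ^ 2 = (Real.cosh x / Real.sinh x) ^ 2 - 1 := by
      have := (Real.sinh_pos_iff.2 hx).ne'
      field_simp
      linarith [Real.cosh_sq x]
    have hm : (0 : ℝ) ≤ (n : ℝ) - 2 := sub_nonneg.2 (by exact_mod_cast hn)
    have hbound := radial_ricci_bound hm (one_le_coth hx) (hψ01 x).1 (hψ01 x).2
      (hψmono.deriv_nonneg (x := x)) (hpos x hx) (hle x hx) hs
    have hfx := (hpos x hx).ne'
    rw [(hderiv x hx).deriv, hdd.deriv, ge_iff_le]
    convert hbound using 1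
    · ring
    · rw [cutoffCoth]
      field_simp
      ring
end
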